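/- arXiv:1703.04668 — 2 statements merged into one kernel-verified Lean document; each statement's English description precedes it below -/
import Mathlib

section
/- If P : ℂ → ℂ is a computable polynomial of degree ≥ 2, then its filled Julia set K(P) is upper computable, i.e., ℂ ∖ K(P) is a lower computable open set. -/
open Complex Metric Set Filter Polynomial

noncomputable section

/-- `x` is a computable real number. -/
def ComputableReal (x : ℝ) : Prop :=
  ∃ g : ℕ → ℚ, Computable g ∧ ∀ n : ℕ, |(g n : ℝ) - x| < (1 / 2) ^ n

/-- `z` is a computable complex number. -/
def ComputableComplex (z : ℂ) : Prop :=
  ComputableReal z.re ∧ ComputableReal z.im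

/-- The point of `ℂ` with rational coordinates `q`. -/
def ratPoint (q : ℚ × ℚ) : ℂ := ⟨(q.1 : ℝ), (q.2 : ℝ)⟩

/-- The rational ball coded by the triple `c` (center coordinates, radius). -/
def ratBall (c : ℚ × ℚ × ℚ) : Set ℂ := Metric.ball (ratPoint (c.1, c.2.1)) (c.2.2 : ℝ)

/-- A computable enumeration of (codes of) rational balls. -/
def ballEnum (n : ℕ) : ℚ × ℚ × ℚ := Denumerable.ofNat (ℚ × ℚ × ℚ) n

/-- `U` is a lower computable (recursively enumerable) open subset of `ℂ`:
it is a union of a computable sequence of rational balls. -/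
def LowerComputableOpen (U : Set ℂ) : Prop :=
  ∃ g : ℕ → ℚ × ℚ × ℚ, Computable g ∧ U = ⋃ n, ratBall (g n)

/-- `K` is a computable (compact) subset of `ℂ`: there is a computable assignment of a
finite list of rational points to each `n`, within Hausdorff distance `2⁻ⁿ` of `K`. -/
def ComputableCompactSet (K : Set ℂ) : Prop :=
  ∃ C : ℕ → List (ℚ × ℚ), Computable C ∧
    ∀ n : ℕ, (C n = [] ↔ K = ∅) ∧
      Metric.hausdorffDist (ratPoint '' {q | q ∈ C n}) K < (1 / 2) ^ n

/-- `x` is a uniformly computable sequence of complex numbers. -/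
def UniformlyComputableSeq (x : ℕ → ℂ) : Prop :=
  ∃ h : ℕ × ℕ → ℚ × ℚ, Computable h ∧
    ∀ n m : ℕ, dist (ratPoint (h (n, m))) (x n) ≤ (1 / 2) ^ m

/-- A compact set `K` is lower computable if some uniformly computable sequence of
points of `K` is dense in `K`. -/
def LowerComputableCompact (K : Set ℂ) : Prop :=
  ∃ x : ℕ → ℂ, (∀ n, x n ∈ K) ∧ UniformlyComputableSeq x ∧ K ⊆ closure (Set.range x)

/-- `f` is computable on `S`: preimages of rational balls are, relative to `S`,
uniformly lower computable open sets. -/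
def ComputableOn (f : ℂ → ℂ) (S : Set ℂ) : Prop :=
  ∃ e : ℕ × ℕ → ℚ × ℚ × ℚ, Computable e ∧
    ∀ n : ℕ, f ⁻¹' ratBall (ballEnum n) ∩ S = (⋃ k, ratBall (e (n, k))) ∩ S

/-- The filled Julia set of `f`: points with bounded forward orbit. -/
def filledJulia (f : ℂ → ℂ) : Set ℂ :=
  {z : ℂ | Bornology.IsBounded (Set.range fun n : ℕ => f^[n] z)}

/-- The Julia set of `f`: the boundary of the filled Julia set. -/
def juliaSet (f : ℂ → ℂ) : Set ℂ := frontier (filledJulia f)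

/-- The external ray of angle `t` (traced by `r ↦ φ (r e^{2πit})`, `r > 1`) lands at `w`. -/
def Lands (φ : ℂ → ℂ) (t : ℝ) (w : ℂ) : Prop :=
  Filter.Tendsto (fun r : ℝ => φ ((r : ℂ) * Complex.exp (2 * Real.pi * Complex.I * (t : ℂ))))
    (nhdsWithin 1 (Set.Ioi 1)) (nhds w)

namespace JuliaAux

section basics
variable {α : Type*} [Primcodable α]

theorem cadd {f g : α → ℕ} (hf : Computable f) (hg : Computable g) :
    Computable fun x => f x + g x := (Primrec.nat_add.to_comp).comp hf hg
theorem cmul {f g : α → ℕ} (hf : Computable f) (hg : Computable g) :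
    Computable fun x => f x * g x := (Primrec.nat_mul.to_comp).comp hf hg
theorem clt {f g : α → ℕ} (hf : Computable f) (hg : Computable g) :
    Computable fun x => decide (f x < g x) :=
  (primrecRel_iff_primrec_decide.1 Primrec.nat_lt).to_comp.comp hf hg
theorem ceq {f g : α → ℕ} (hf : Computable f) (hg : Computable g) :
    Computable fun x => decide (f x = g x) :=
  (primrecRel_iff_primrec_decide.1 (Primrec.eq (α := ℕ))).to_comp.comp hf hg
theorem cand {f g : α → Bool} (hf : Computable f) (hg : Computable g) :
    Computable fun x => (f x && g x) :=
  (Primrec.and).to_comp.comp hf hg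

/-- a function into a denumerable type with computable graph is computable -/
theorem of_graph {β : Type*} [Denumerable β] {f : α → β} {R : α → β → Bool}
    (hR : Computable₂ R) (h : ∀ a b, R a b = true ↔ b = f a) : Computable f := by
  have h1 : Computable₂ fun (a : α) (n : ℕ) => R a (Denumerable.ofNat β n) :=
    hR.comp Computable.fst ((Computable.ofNat β).comp Computable.snd)
  have h2 : Partrec fun a => Nat.rfind fun n => Part.some (R a (Denumerable.ofNat β n)) :=
    Partrec.rfind (p := fun a n => Part.some (R a (Denumerable.ofNat β n))) h1
  rw [← Computable.encode_iff]
  refine h2.of_eq_tot fun a => ?_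
  refine Nat.mem_rfind.2 ⟨?_, ?_⟩
  · simp only [Part.mem_some_iff, Denumerable.ofNat_encode]
    exact ((h _ _).2 rfl).symm
  · intro m hm
    simp only [Part.mem_some_iff]
    symm
    rw [Bool.eq_false_iff]
    intro hc
    rw [h] at hc
    rw [← hc] at hm
    simp at hm

end basics

/-- original encoding of rationals -/
def E (q : ℚ) : ℕ := @Encodable.encode ℚ Rat.instEncodable q

def absCode (a : ℕ) : ℕ := if a.bodd then a.div2 + 1 else a.div2

theorem encode_int (z : ℤ) : Encodable.encode z = if z < 0 then 2 * ((-z).toNat - 1) + 1 else 2 * z.toNat := by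
  cases z with
  | ofNat n => 
    have : ¬ (Int.ofNat n < 0) := by simp
    rw [if_neg this]; rfl
  | negSucc n => 
    rw [if_pos (Int.negSucc_lt_zero n)]
    have : ((-Int.negSucc n).toNat - 1) = n := by simp [Int.neg_negSucc]
    rw [this]; rfl

theorem E_eq (q : ℚ) : E q = Nat.pair (Encodable.encode q.num) q.den := rfl

theorem absCode_encode (z : ℤ) : absCode (Encodable.encode z) = z.natAbs := by
  rw [encode_int]
  split_ifs with h
  · simp [absCode]; omega
  · simp [absCode]; omega

def inS (k : ℕ) : Prop :=
  0 < k.unpair.2 ∧ (absCode k.unpair.1).Coprime k.unpair.2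

instance : DecidablePred inS := fun k => by unfold inS; infer_instance

theorem mem_range_E (k : ℕ) : k ∈ Set.range E ↔ inS k := by
  constructor
  · rintro ⟨q, rfl⟩
    rw [E_eq, inS]
    simp only [Nat.unpair_pair, absCode_encode]
    exact ⟨q.pos, q.reduced⟩
  · rintro ⟨h1, h2⟩
    have hz : Encodable.encode (Denumerable.ofNat ℤ k.unpair.1) = k.unpair.1 :=
      Denumerable.encode_ofNat _
    refine ⟨⟨Denumerable.ofNat ℤ k.unpair.1, k.unpair.2, h1.ne', ?_⟩, ?_⟩
    · rw [← absCode_encode, hz]; exact h2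
    · rw [E_eq]; simp only
      rw [hz, Nat.pair_unpair]

theorem comp_absCode : Computable absCode := by
  have := Computable.cond Computable.nat_bodd (cadd Computable.nat_div2 (Computable.const 1))
    Computable.nat_div2
  refine this.of_eq fun n => ?_
  unfold absCode
  cases n.bodd <;> simp

theorem primrec_gcd : Computable₂ (Nat.gcd) := by
  have h : Primrec₂ fun (p : Unit) (l : ℕ × ℕ) => Nat.gcd l.1 l.2 := by
    refine Primrec.nat_omega_rec (fun (_ : Unit) (l : ℕ × ℕ) => Nat.gcd l.1 l.2)
      (m := fun _ l => l.1)
      (l := fun _ l => if l.1 = 0 then [] else [(l.2 % l.1, l.1)])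
      (g := fun _ x => if x.1.1 = 0 then some x.1.2 else x.2.head?) ?_ ?_ ?_ ?_ ?_
    · exact Primrec.fst.comp Primrec.snd
    · refine Primrec.ite ?_ (Primrec.const _) ?_
      · exact Primrec.eq.comp (Primrec.fst.comp Primrec.snd) (Primrec.const 0)
      · refine Primrec.list_cons.comp (Primrec.pair ?_ (Primrec.fst.comp Primrec.snd)) (Primrec.const [])
        exact Primrec.nat_mod.comp (Primrec.snd.comp Primrec.snd) (Primrec.fst.comp Primrec.snd)
    · refine Primrec.ite ?_ ?_ ?_
      · exact Primrec.eq.comp (Primrec.fst.comp (Primrec.fst.comp Primrec.snd)) (Primrec.const 0)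
      · exact Primrec.option_some.comp (Primrec.snd.comp (Primrec.fst.comp Primrec.snd))
      · exact Primrec.list_head?.comp (Primrec.snd.comp Primrec.snd)
    · intro _ b b' hb'
      by_cases h : b.1 = 0
      · simp [h] at hb'
      · simp [h] at hb'
        subst hb'
        exact Nat.mod_lt _ (Nat.pos_of_ne_zero h)
    · intro _ b
      by_cases h : b.1 = 0
      · simp [h]
      · simp [h]
        exact (Nat.gcd_rec _ _).symm
  have h' := h.to_comp
  exact (h'.comp (Computable.const ()) (Computable.id)).to₂

theorem comp_inS : Computable fun k => decide (inS k) := by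
  have := cand (clt (Computable.const 0) (Computable.snd.comp Computable.unpair))
    (ceq (primrec_gcd.comp (comp_absCode.comp (Computable.fst.comp Computable.unpair)) (Computable.snd.comp Computable.unpair)) (Computable.const 1))
  refine this.of_eq fun k => ?_
  rw [Bool.eq_iff_iff, decide_eq_true_iff, Bool.and_eq_true, decide_eq_true_iff,
    decide_eq_true_iff]
  rfl

theorem E_ofNat_strictMono : StrictMono fun n => E (Denumerable.ofNat ℚ n) := by
  let := @Encodable.decidableRangeEncode ℚ Rat.instEncodable
  let : Infinite (Set.range (@Encodable.encode ℚ Rat.instEncodable)) :=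
    Infinite.of_injective _ (Equiv.ofInjective _ (@Encodable.encode_injective ℚ Rat.instEncodable)).injective
  have key : ∀ n, E (Denumerable.ofNat ℚ n) =
      (Nat.Subtype.ofNat (Set.range (@Encodable.encode ℚ Rat.instEncodable)) n : ℕ) := by
    intro n
    have h : Denumerable.ofNat ℚ n = (@Encodable.equivRangeEncode ℚ Rat.instEncodable).symm
       (Nat.Subtype.ofNat (Set.range (@Encodable.encode ℚ Rat.instEncodable)) n) := by
      rfl
    rw [h]
    have := (@Encodable.equivRangeEncode ℚ Rat.instEncodable).apply_symm_apply (Nat.Subtype.ofNat (Set.range (@Encodable.encode ℚ Rat.instEncodable)) n)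
    exact congrArg Subtype.val this
  refine strictMono_nat_of_lt_succ fun n => ?_
  simp only [key]
  exact Nat.Subtype.lt_succ_self (Nat.Subtype.ofNat (Set.range (@Encodable.encode ℚ Rat.instEncodable)) n)

def encD (q : ℚ) : ℕ := @Encodable.encode ℚ Rat.instDenumerable.toEncodable q

theorem ofNat_encD (q : ℚ) : Denumerable.ofNat ℚ (encD q) = q := Denumerable.ofNat_encode q

theorem encD_injective : Function.Injective encD := fun a b h => by
  rw [← ofNat_encD a, h, ofNat_encD]

theorem comp_encD : Computable encD := Computable.encode

theorem count_E (q : ℚ) : Nat.count inS (E q) = encD q := by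
  set n := encD q with hn
  have hq : q = Denumerable.ofNat ℚ n := by rw [hn, ofNat_encD]
  rw [hq, Nat.count_eq_card_filter_range]
  have : {x ∈ Finset.range (E (Denumerable.ofNat ℚ n)) | inS x} =
      (Finset.range n).image fun n => E (Denumerable.ofNat ℚ n) := by
    ext k
    simp only [Finset.mem_filter, Finset.mem_range, Finset.mem_image]
    constructor
    · rintro ⟨h1, h2⟩
      obtain ⟨r, rfl⟩ := (mem_range_E k).2 h2
      refine ⟨encD r, ?_, by rw [ofNat_encD]⟩
      rw [← E_ofNat_strictMono.lt_iff_lt]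
      simpa only [ofNat_encD] using h1
    · rintro ⟨a, h1, rfl⟩
      exact ⟨E_ofNat_strictMono h1, (mem_range_E _).1 ⟨_, rfl⟩⟩
  rw [this, Finset.card_image_of_injective _ E_ofNat_strictMono.injective, Finset.card_range]

theorem comp_count : Computable (Nat.count inS) := by
  have h : Computable fun n : ℕ => (Nat.rec 0 (fun k c => c + bif decide (inS k) then 1 else 0) n : ℕ) := by
    refine Computable.nat_rec (h := fun (_ : ℕ) (p : ℕ × ℕ) => p.2 + bif decide (inS p.1) then 1 else 0)
      Computable.id (Computable.const 0) ?_
    refine cadd (Computable.snd.comp Computable.snd) (Computable.cond ?_ (Computable.const 1) (Computable.const 0))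
    exact comp_inS.comp (Computable.fst.comp Computable.snd)
  refine h.of_eq fun n => ?_
  induction n with
  | zero => simp
  | succ n ih =>
    rw [Nat.count_succ, ← ih]
    by_cases hn : inS n <;> simp [hn]

theorem comp_E : Computable E := by
  refine of_graph (R := fun q k => decide (inS k) && decide (Nat.count inS k = encD q)) ?_ ?_
  · exact cand (comp_inS.comp Computable.snd)
      (ceq (comp_count.comp Computable.snd) (comp_encD.comp Computable.fst))
  · intro q k
    rw [Bool.and_eq_true, decide_eq_true_iff, decide_eq_true_iff]
    constructor
    · rintro ⟨h1, h2⟩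
      obtain ⟨r, rfl⟩ := (mem_range_E k).2 h1
      rw [count_E] at h2
      rw [encD_injective h2]
    · rintro rfl
      exact ⟨(mem_range_E _).1 ⟨_, rfl⟩, count_E q⟩

/-- positive part of the numerator -/
def pp (q : ℚ) : ℕ := bif (E q).unpair.1.bodd then 0 else (E q).unpair.1.div2
/-- negative part of the numerator -/
def nn (q : ℚ) : ℕ := bif (E q).unpair.1.bodd then (E q).unpair.1.div2 + 1 else 0
def dd (q : ℚ) : ℕ := (E q).unpair.2

theorem comp_pp : Computable pp := by
  have h := Computable.fst.comp (Computable.unpair.comp comp_E)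
  exact Computable.cond (Computable.nat_bodd.comp h) (Computable.const 0) (Computable.nat_div2.comp h)
theorem comp_nn : Computable nn := by
  have h := Computable.fst.comp (Computable.unpair.comp comp_E)
  exact Computable.cond (Computable.nat_bodd.comp h)
    (cadd (Computable.nat_div2.comp h) (Computable.const 1)) (Computable.const 0)
theorem comp_dd : Computable dd := Computable.snd.comp (Computable.unpair.comp comp_E)

theorem dd_eq (q : ℚ) : dd q = q.den := by simp [dd, E_eq]
theorem dd_pos (q : ℚ) : (0 : ℚ) < dd q := by rw [dd_eq]; exact_mod_cast q.pos
theorem num_eq (q : ℚ) : q.num = (pp q : ℤ) - nn q := by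
  simp only [pp, nn, E_eq, Nat.unpair_pair, encode_int]
  split_ifs with h
  · simp; omega
  · simp; exact Rat.num_nonneg.1 (not_lt.1 h)
theorem rat_eq (q : ℚ) : q = ((pp q : ℚ) - nn q) / dd q := by
  conv_lhs => rw [← Rat.num_div_den q, num_eq, ← dd_eq]
  push_cast; rfl

section ratops
variable {α : Type*} [Primcodable α]

theorem rat_add {f g : α → ℚ} (hf : Computable f) (hg : Computable g) :
    Computable fun x => f x + g x := by
  refine of_graph (R := fun a q => decide
    (pp q * dd (f a) * dd (g a) + nn (f a) * dd (g a) * dd q + nn (g a) * dd (f a) * dd q =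
     nn q * dd (f a) * dd (g a) + pp (f a) * dd (g a) * dd q + pp (g a) * dd (f a) * dd q)) ?_ ?_
  · have hf' := hf.comp (Computable.fst (α := α) (β := ℚ))
    have hg' := hg.comp (Computable.fst (α := α) (β := ℚ))
    have hq := (Computable.snd (α := α) (β := ℚ))
    exact ceq
      (cadd (cadd (cmul (cmul (comp_pp.comp hq) (comp_dd.comp hf')) (comp_dd.comp hg'))
        (cmul (cmul (comp_nn.comp hf') (comp_dd.comp hg')) (comp_dd.comp hq)))
        (cmul (cmul (comp_nn.comp hg') (comp_dd.comp hf')) (comp_dd.comp hq)))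
      (cadd (cadd (cmul (cmul (comp_nn.comp hq) (comp_dd.comp hf')) (comp_dd.comp hg'))
        (cmul (cmul (comp_pp.comp hf') (comp_dd.comp hg')) (comp_dd.comp hq)))
        (cmul (cmul (comp_pp.comp hg') (comp_dd.comp hf')) (comp_dd.comp hq)))
  · intro a q
    rw [decide_eq_true_iff, ← Nat.cast_inj (R := ℚ)]
    have h1 := (dd_pos q).ne'
    have h2 := (dd_pos (f a)).ne'
    have h3 := (dd_pos (g a)).ne'
    conv_rhs => rw [rat_eq q, rat_eq (f a), rat_eq (g a)]
    push_cast
    field_simp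
    constructor <;> intro h <;> linarith

theorem rat_mul {f g : α → ℚ} (hf : Computable f) (hg : Computable g) :
    Computable fun x => f x * g x := by
  refine of_graph (R := fun a q => decide
    (pp q * dd (f a) * dd (g a) + (nn (f a) * pp (g a) + pp (f a) * nn (g a)) * dd q =
     nn q * dd (f a) * dd (g a) + (pp (f a) * pp (g a) + nn (f a) * nn (g a)) * dd q)) ?_ ?_
  · have hf' := hf.comp (Computable.fst (α := α) (β := ℚ))
    have hg' := hg.comp (Computable.fst (α := α) (β := ℚ))
    have hq := (Computable.snd (α := α) (β := ℚ))
    exact ceq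
      (cadd (cmul (cmul (comp_pp.comp hq) (comp_dd.comp hf')) (comp_dd.comp hg'))
        (cmul (cadd (cmul (comp_nn.comp hf') (comp_pp.comp hg'))
          (cmul (comp_pp.comp hf') (comp_nn.comp hg'))) (comp_dd.comp hq)))
      (cadd (cmul (cmul (comp_nn.comp hq) (comp_dd.comp hf')) (comp_dd.comp hg'))
        (cmul (cadd (cmul (comp_pp.comp hf') (comp_pp.comp hg'))
          (cmul (comp_nn.comp hf') (comp_nn.comp hg'))) (comp_dd.comp hq)))
  · intro a q
    rw [decide_eq_true_iff, ← Nat.cast_inj (R := ℚ)]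
    have h1 := (dd_pos q).ne'
    have h2 := (dd_pos (f a)).ne'
    have h3 := (dd_pos (g a)).ne'
    conv_rhs => rw [rat_eq q, rat_eq (f a), rat_eq (g a)]
    push_cast
    field_simp
    constructor <;> intro h <;> linarith

theorem rat_lt {f g : α → ℚ} (hf : Computable f) (hg : Computable g) :
    Computable fun x => decide (f x < g x) := by
  have h := clt (cadd (cmul (comp_pp.comp hf) (comp_dd.comp hg)) (cmul (comp_nn.comp hg) (comp_dd.comp hf)))
    (cadd (cmul (comp_pp.comp hg) (comp_dd.comp hf)) (cmul (comp_nn.comp hf) (comp_dd.comp hg)))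
  refine h.of_eq fun a => ?_
  rw [decide_eq_decide, ← Nat.cast_lt (α := ℚ)]
  conv_rhs => rw [rat_eq (f a), rat_eq (g a)]
  rw [div_lt_div_iff₀ (dd_pos _) (dd_pos _)]
  push_cast
  constructor <;> intro h <;> linarith

theorem rat_sub {f g : α → ℚ} (hf : Computable f) (hg : Computable g) :
    Computable fun x => f x - g x := by
  refine (rat_add hf (rat_mul (Computable.const (-1)) hg)).of_eq fun a => ?_
  ring

theorem rat_pow (r : ℚ) {f : α → ℕ} (hf : Computable f) : Computable fun x => r ^ f x := by
  have h : Computable fun n : α => (Nat.rec 1 (fun _ c => c * r) (f n) : ℚ) := by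
    refine Computable.nat_rec (h := fun (_ : α) (p : ℕ × ℚ) => p.2 * r)
      hf (Computable.const 1) ?_
    exact rat_mul (Computable.snd.comp Computable.snd) (Computable.const r)
  refine h.of_eq fun n => ?_
  induction f n with
  | zero => simp
  | succ n ih => rw [pow_succ, ← ih]

end ratops

theorem ratPoint_add (a b : ℚ × ℚ) :
    ratPoint (a.1 + b.1, a.2 + b.2) = ratPoint a + ratPoint b := by
  apply Complex.ext <;> simp [ratPoint]

theorem ratPoint_mul (a b : ℚ × ℚ) :
    ratPoint (a.1 * b.1 - a.2 * b.2, a.1 * b.2 + a.2 * b.1) = ratPoint a * ratPoint b := by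
  apply Complex.ext <;> simp [ratPoint]

theorem approx_complex {z : ℂ} (hz : ComputableComplex z) :
    ∃ g : ℕ → ℚ × ℚ, Computable g ∧ ∀ m, ‖ratPoint (g m) - z‖ ≤ 2 * (1 / 2) ^ m := by
  obtain ⟨⟨g, hg, hg'⟩, ⟨h, hh, hh'⟩⟩ := hz
  refine ⟨fun m => (g m, h m), hg.pair hh, fun m => ?_⟩
  refine (Complex.norm_le_abs_re_add_abs_im _).trans ?_
  have h1 := (hg' m).le
  have h2 := (hh' m).le
  simp only [ratPoint, Complex.sub_re, Complex.sub_im]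
  linarith

theorem approx_poly (n : ℕ) : ∀ (P : Polynomial ℂ), (∀ i, ComputableComplex (P.coeff i)) →
    (∀ i, n ≤ i → P.coeff i = 0) →
    ∃ F : ℕ × (ℚ × ℚ) → ℚ × ℚ, Computable F ∧ ∀ R : ℝ, 0 ≤ R → ∃ C : ℝ, 0 ≤ C ∧ ∀ m w,
      ‖ratPoint w‖ ≤ R → ‖ratPoint (F (m, w)) - P.eval (ratPoint w)‖ ≤ C * (1 / 2) ^ m := by
  induction n with
  | zero =>
    intro P _ h0
    have hP : P = 0 := by
      ext i
      simpa using h0 i (Nat.zero_le _)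
    refine ⟨fun _ => (0, 0), Computable.const _, fun R _ => ⟨0, le_rfl, fun m w _ => ?_⟩⟩
    have : ratPoint (0, 0) = 0 := by apply Complex.ext <;> simp [ratPoint]
    simp [hP, this]
  | succ n ih =>
    intro P hP h0
    obtain ⟨F, hF, hF'⟩ := ih P.divX (fun i => by rw [Polynomial.coeff_divX]; exact hP _)
      (fun i hi => by rw [Polynomial.coeff_divX]; exact h0 _ (by omega))
    obtain ⟨g, hg, hg'⟩ := approx_complex (hP 0)
    let M : ℕ × (ℚ × ℚ) → ℚ × ℚ := fun x =>
      ((F x).1 * x.2.1 - (F x).2 * x.2.2, (F x).1 * x.2.2 + (F x).2 * x.2.1)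
    have h1 : Computable fun x : ℕ × (ℚ × ℚ) => (F x).1 := Computable.fst.comp hF
    have h2 : Computable fun x : ℕ × (ℚ × ℚ) => (F x).2 := Computable.snd.comp hF
    have h3 : Computable fun x : ℕ × (ℚ × ℚ) => x.2.1 := Computable.fst.comp Computable.snd
    have h4 : Computable fun x : ℕ × (ℚ × ℚ) => x.2.2 := Computable.snd.comp Computable.snd
    have hM : Computable M := (rat_sub (rat_mul h1 h3) (rat_mul h2 h4)).pair
      (rat_add (rat_mul h1 h4) (rat_mul h2 h3))
    have hg1 : Computable fun x : ℕ × (ℚ × ℚ) => g x.1 := hg.comp Computable.fst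
    refine ⟨fun x => ((M x).1 + (g x.1).1, (M x).2 + (g x.1).2),
      (rat_add (Computable.fst.comp hM) (Computable.fst.comp hg1)).pair
      (rat_add (Computable.snd.comp hM) (Computable.snd.comp hg1)), fun R hR => ?_⟩
    obtain ⟨C, hC, hC'⟩ := hF' R hR
    refine ⟨C * R + 2, by positivity, fun m w hw => ?_⟩
    rw [ratPoint_add]
    have hMe : ratPoint (M (m, w)) = ratPoint (F (m, w)) * ratPoint w := ratPoint_mul _ _
    rw [hMe]
    have hPe : P.eval (ratPoint w) = P.divX.eval (ratPoint w) * ratPoint w + P.coeff 0 := by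
      conv_lhs => rw [← Polynomial.divX_mul_X_add P]
      simp
    rw [hPe]
    have e : ratPoint (F (m, w)) * ratPoint w + ratPoint (g m)
        - (P.divX.eval (ratPoint w) * ratPoint w + P.coeff 0)
        = (ratPoint (F (m, w)) - P.divX.eval (ratPoint w)) * ratPoint w
          + (ratPoint (g m) - P.coeff 0) := by ring
    rw [e]
    refine (norm_add_le _ _).trans ?_
    rw [norm_mul]
    have a1 := mul_le_mul (hC' m w hw) hw (norm_nonneg _) (by positivity)
    have a2 := hg' m
    linarith

theorem exists_lip (P : Polynomial ℂ) (R : ℝ) : ∃ L : ℝ, 0 ≤ L ∧ ∀ x y : ℂ, ‖x‖ ≤ R → ‖y‖ ≤ R →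
    ‖P.eval x - P.eval y‖ ≤ L * ‖x - y‖ := by
  obtain ⟨L, hL⟩ := (isCompact_closedBall (0 : ℂ) R).exists_bound_of_continuousOn
    (f := fun z => P.derivative.eval z) P.derivative.continuous.continuousOn
  refine ⟨max L 0, le_max_right _ _, fun x y hx hy => ?_⟩
  refine (convex_closedBall (0 : ℂ) R).norm_image_sub_le_of_norm_hasDerivWithin_le
    (f := fun z => P.eval z) (f' := fun z => P.derivative.eval z)
    (fun z _ => (P.hasDerivAt z).hasDerivWithinAt) (fun z hz => (hL z hz).trans (le_max_left _ _)) ?_ ?_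
  · simpa using hy
  · simpa using hx

theorem escape (P : Polynomial ℂ) (hdeg : 2 ≤ P.natDegree) :
    ∃ R : ℕ, ∀ z ∈ filledJulia (fun z : ℂ => P.eval z), ‖z‖ ≤ R := by
  have hd : 0 < P.divX.degree := by
    rw [← Polynomial.natDegree_pos_iff_degree_pos, Polynomial.natDegree_divX_eq_natDegree_tsub_one]
    omega
  have h1 : Tendsto (fun z : ℂ => ‖P.divX.eval z‖) (Bornology.cobounded ℂ) atTop :=
    P.divX.tendsto_norm_atTop hd tendsto_norm_cobounded_atTop
  have h2 := h1.eventually_ge_atTop 3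
  rw [(Metric.hasBasis_cobounded_compl_closedBall (0 : ℂ)).eventually_iff] at h2
  obtain ⟨r, -, hr⟩ := h2
  obtain ⟨R, hR⟩ := exists_nat_gt (max (max r 1) ‖P.coeff 0‖)
  rw [max_lt_iff, max_lt_iff] at hR
  obtain ⟨⟨hR1, hR2⟩, hR3⟩ := hR
  have key : ∀ z : ℂ, (R : ℝ) < ‖z‖ → 2 * ‖z‖ ≤ ‖P.eval z‖ := by
    intro z hz
    have hPe : P.eval z = P.divX.eval z * z + P.coeff 0 := by
      conv_lhs => rw [← Polynomial.divX_mul_X_add P]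
      simp
    have h3 : 3 ≤ ‖P.divX.eval z‖ := hr (by simp; linarith)
    have h4 : ‖P.divX.eval z * z‖ - ‖P.coeff 0‖ ≤ ‖P.eval z‖ := by
      rw [hPe]
      have := norm_sub_le (P.divX.eval z * z + P.coeff 0) (P.coeff 0)
      rw [add_sub_cancel_right] at this
      linarith
    rw [norm_mul] at h4
    have := mul_le_mul_of_nonneg_right h3 (norm_nonneg z)
    linarith
  refine ⟨R, fun z hz => ?_⟩
  by_contra! hzR
  have grow : ∀ n : ℕ, 2 ^ n * ‖z‖ ≤ ‖(fun z : ℂ => P.eval z)^[n] z‖ := by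
    intro n
    induction n with
    | zero => simp
    | succ n ih =>
      rw [Function.iterate_succ_apply']
      have h5 : (1 : ℝ) ≤ 2 ^ n := one_le_pow₀ (by norm_num)
      have h6 := mul_le_mul_of_nonneg_right h5 (norm_nonneg z)
      have := key ((fun z : ℂ => P.eval z)^[n] z) (by linarith)
      rw [pow_succ]
      linarith
  have hz' : Bornology.IsBounded (Set.range fun n : ℕ => (fun z : ℂ => P.eval z)^[n] z) := hz
  obtain ⟨B, hB⟩ := isBounded_iff_forall_norm_le.1 hz'
  obtain ⟨n, hn⟩ := pow_unbounded_of_one_lt B (one_lt_two)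
  have h7 := hB _ ⟨n, rfl⟩
  have h8 := grow n
  have h9 : (2 : ℝ) ^ n * 1 ≤ 2 ^ n * ‖z‖ :=
    mul_le_mul_of_nonneg_left (by linarith) (by positivity)
  simp only at h7
  linarith

theorem K_iterate (f : ℂ → ℂ) {z : ℂ} (hz : z ∈ filledJulia f) (n : ℕ) : f^[n] z ∈ filledJulia f := by
  have hz' : Bornology.IsBounded (Set.range fun n : ℕ => f^[n] z) := hz
  refine hz'.subset ?_
  rintro _ ⟨k, rfl⟩
  exact ⟨k + n, by simp only [Function.iterate_add_apply]⟩

/-- Error propagation. -/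
theorem track (f : ℂ → ℂ) (G : ℚ × ℚ → ℚ × ℚ) (R ε : ℝ) (L : ℝ) (hL : 1 ≤ L) (hε : 0 ≤ ε)
    (hstep : ∀ w z e, ‖z‖ ≤ R → ‖ratPoint w‖ ≤ R + 1 → ε ≤ e → ‖ratPoint w - z‖ ≤ e →
      ‖ratPoint (G w) - f z‖ ≤ L * e)
    (w : ℚ × ℚ) (z : ℂ) (h0 : ‖ratPoint w - z‖ ≤ ε) (k : ℕ) (hk : L ^ k * ε ≤ 1)
    (horb : ∀ j < k, ‖f^[j] z‖ ≤ R) : ‖ratPoint (G^[k] w) - f^[k] z‖ ≤ 1 := by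
  have main : ∀ j ≤ k, ‖ratPoint (G^[j] w) - f^[j] z‖ ≤ L ^ j * ε := by
    intro j
    induction j with
    | zero => intro _; simpa using h0
    | succ j ih =>
      intro hj
      have h1 := ih (by omega)
      have h2 := horb j (by omega)
      have h3 : L ^ j * ε ≤ 1 :=
        (mul_le_mul_of_nonneg_right (pow_le_pow_right₀ hL (by omega)) hε).trans hk
      rw [Function.iterate_succ_apply', Function.iterate_succ_apply', pow_succ', mul_assoc]
      refine hstep _ _ _ h2 ?_ ?_ h1
      · have := norm_sub_norm_le (ratPoint (G^[j] w)) (f^[j] z)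
        linarith
      · have : (1 : ℝ) ≤ L ^ j := one_le_pow₀ hL
        nlinarith
  exact (main k le_rfl).trans hk

theorem exists_ratPoint (z : ℂ) (ε : ℝ) (hε : 0 < ε) : ∃ q, ‖ratPoint q - z‖ < ε := by
  obtain ⟨a, ha1, ha2⟩ := exists_rat_btwn (show z.re < z.re + ε / 2 by linarith)
  obtain ⟨b, hb1, hb2⟩ := exists_rat_btwn (show z.im < z.im + ε / 2 by linarith)
  refine ⟨(a, b), (Complex.norm_le_abs_re_add_abs_im _).trans_lt ?_⟩
  simp only [ratPoint, Complex.sub_re, Complex.sub_im]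
  rw [abs_of_pos (by linarith), abs_of_pos (by linarith)]
  linarith

theorem norm_ratPoint_gt (w : ℚ × ℚ) (R : ℕ) :
    ((R : ℚ) + 1) ^ 2 < w.1 * w.1 + w.2 * w.2 ↔ (R : ℝ) + 1 < ‖ratPoint w‖ := by
  have h1 : ‖ratPoint w‖ ^ 2 = (w.1 : ℝ) * w.1 + w.2 * w.2 := by
    rw [← Complex.normSq_eq_norm_sq, Complex.normSq_apply]; rfl
  rw [← pow_lt_pow_iff_left₀ (by positivity) (norm_nonneg _) two_ne_zero, h1]
  exact_mod_cast Iff.rfl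

end JuliaAux

open JuliaAux

/-- The filled Julia set of a computable polynomial of degree ≥ 2 is
upper computable: its complement is a lower computable open set. -/
theorem filledJulia_upperComputable (P : Polynomial ℂ) (hdeg : 2 ≤ P.natDegree)
    (hP : ∀ i : ℕ, ComputableComplex (P.coeff i)) :
    LowerComputableOpen (filledJulia (fun z : ℂ => P.eval z))ᶜ := by
  obtain ⟨R, hR⟩ := escape P hdeg
  obtain ⟨F, hF, hF'⟩ := approx_poly (P.natDegree + 1) P hP
    (fun i hi => Polynomial.coeff_eq_zero_of_natDegree_lt (by omega))
  obtain ⟨C, hC0, hC⟩ := hF' (R + 2 + 1) (by positivity)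
  obtain ⟨A, hA0, hA⟩ := exists_lip P (R + 2 + 1)
  obtain ⟨L, hL⟩ := exists_nat_gt (A + C + 1)
  have hL1 : (1 : ℝ) ≤ L := by linarith
  set f : ℂ → ℂ := fun z => P.eval z with hf
  have hstep : ∀ (m : ℕ) (w : ℚ × ℚ) (z : ℂ) (e : ℝ), ‖z‖ ≤ R + 2 → ‖ratPoint w‖ ≤ R + 2 + 1 →
      (1 / 2 : ℝ) ^ m ≤ e → ‖ratPoint w - z‖ ≤ e → ‖ratPoint (F (m, w)) - f z‖ ≤ L * e := by
    intro m w z e hz hw he hwz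
    have h1 := hC m w hw
    have h2 := hA (ratPoint w) z hw (by linarith)
    have h3 := norm_sub_le_norm_sub_add_norm_sub (ratPoint (F (m, w))) (P.eval (ratPoint w)) (f z)
    have he0 : 0 ≤ e := (norm_nonneg _).trans hwz
    have h4 : C * (1 / 2) ^ m ≤ C * e := mul_le_mul_of_nonneg_left he hC0
    have h5 : A * ‖ratPoint w - z‖ ≤ A * e := mul_le_mul_of_nonneg_left hwz hA0
    have h6 : (A + C) * e ≤ L * e := mul_le_mul_of_nonneg_right (by linarith) he0
    have h7 : ‖P.eval (ratPoint w) - f z‖ ≤ A * ‖ratPoint w - z‖ := h2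
    linarith
  -- the certificate
  let W : (ℚ × ℚ) × ℕ × ℕ → ℚ × ℚ := fun x => (fun w => F (x.2.1, w))^[x.2.2] x.1
  have hW : Computable W := by
    have h : Computable fun x : (ℚ × ℚ) × ℕ × ℕ =>
        (Nat.rec x.1 (fun _ w => F (x.2.1, w)) x.2.2 : ℚ × ℚ) := by
      refine Computable.nat_rec
        (h := fun (x : (ℚ × ℚ) × ℕ × ℕ) (p : ℕ × (ℚ × ℚ)) => F (x.2.1, p.2))
        (Computable.snd.comp Computable.snd) Computable.fst ?_
      exact hF.comp (((Computable.fst.comp Computable.snd).comp Computable.fst).pair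
        (Computable.snd.comp Computable.snd))
    refine h.of_eq fun x => ?_
    obtain ⟨q, m, k⟩ := x
    simp only [W]
    induction k with
    | zero => rfl
    | succ k ih =>
      rw [Function.iterate_succ_apply', ← ih]
  let T : (ℚ × ℚ) × ℕ × ℕ → Bool := fun x =>
    decide ((L : ℚ) ^ x.2.2 * (1 / 2) ^ x.2.1 < 1) &&
      decide (((R : ℚ) + 1) ^ 2 < (W x).1 * (W x).1 + (W x).2 * (W x).2)
  have hm : Computable fun x : (ℚ × ℚ) × ℕ × ℕ => x.2.1 := Computable.fst.comp Computable.snd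
  have hk : Computable fun x : (ℚ × ℚ) × ℕ × ℕ => x.2.2 := Computable.snd.comp Computable.snd
  have hT : Computable T := by
    refine cand (rat_lt (rat_mul (rat_pow _ hk) (rat_pow _ hm)) (Computable.const 1)) ?_
    have h1 := Computable.fst.comp hW
    have h2 := Computable.snd.comp hW
    exact rat_lt (Computable.const _) (rat_add (rat_mul h1 h1) (rat_mul h2 h2))
  have hTiff : ∀ x, T x = true ↔ (L : ℝ) ^ x.2.2 * (1 / 2) ^ x.2.1 < 1 ∧
      (R : ℝ) + 1 < ‖ratPoint (W x)‖ := by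
    intro x
    simp only [T]
    rw [Bool.and_eq_true, decide_eq_true_iff, decide_eq_true_iff, norm_ratPoint_gt]
    refine and_congr_left fun _ => ?_
    rw [← Rat.cast_lt (K := ℝ)]
    push_cast
    exact Iff.rfl
  let H : (ℚ × ℚ) × ℕ × ℕ → ℚ × ℚ × ℚ := fun x =>
    bif T x then (x.1.1, x.1.2, (1 / 2) ^ x.2.1) else (0, 0, 0)
  have hH : Computable H := by
    refine Computable.cond hT ?_ (Computable.const _)
    exact (Computable.fst.comp Computable.fst).pair ((Computable.snd.comp Computable.fst).pair
      (rat_pow _ hm))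
  let D : ℕ → (ℚ × ℚ) × ℕ × ℕ := fun n =>
    ((Denumerable.ofNat ℚ n.unpair.1.unpair.1, Denumerable.ofNat ℚ n.unpair.1.unpair.2),
      n.unpair.2.unpair)
  have hD : Computable D := by
    have u1 := Computable.unpair.comp (Computable.fst.comp Computable.unpair)
    have u2 := Computable.unpair.comp (Computable.snd.comp Computable.unpair)
    exact (((Computable.ofNat ℚ).comp (Computable.fst.comp u1)).pair
      ((Computable.ofNat ℚ).comp (Computable.snd.comp u1))).pair u2
  have hDsurj : ∀ x, ∃ n, D n = x := by
    rintro ⟨⟨a, b⟩, m, k⟩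
    refine ⟨Nat.pair (Nat.pair (encD a) (encD b)) (Nat.pair m k), ?_⟩
    simp only [D, Nat.unpair_pair, ofNat_encD]
  refine ⟨fun n => H (D n), hH.comp hD, ?_⟩
  ext z
  rw [mem_iUnion]
  constructor
  · intro hz
    have hex : ∃ k, (R : ℝ) + 2 < ‖f^[k] z‖ := by
      by_contra! hcon
      apply hz
      show Bornology.IsBounded (Set.range fun n : ℕ => f^[n] z)
      refine isBounded_iff_forall_norm_le.2 ⟨R + 2, ?_⟩
      rintro _ ⟨k, rfl⟩
      exact hcon k
    classical
    let k := Nat.find hex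
    have hk1 : (R : ℝ) + 2 < ‖f^[k] z‖ := Nat.find_spec hex
    have hk2 : ∀ j < k, ‖f^[j] z‖ ≤ R + 2 := fun j hj => not_lt.1 (Nat.find_min hex hj)
    obtain ⟨m, hm'⟩ := pow_unbounded_of_one_lt ((L : ℝ) ^ k) one_lt_two
    have hLm : (L : ℝ) ^ k * (1 / 2) ^ m < 1 := by
      rw [one_div, inv_pow, ← div_eq_mul_inv, div_lt_one (by positivity)]
      exact hm'
    obtain ⟨q, hq⟩ := exists_ratPoint z ((1 / 2) ^ m) (by positivity)
    obtain ⟨n, hn⟩ := hDsurj (q, m, k)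
    refine ⟨n, ?_⟩
    have ht := track f (fun w => F (m, w)) (R + 2) ((1 / 2) ^ m) L hL1 (by positivity) (hstep m)
      q z hq.le k hLm.le hk2
    have hTt : T (q, m, k) = true := by
      rw [hTiff]
      refine ⟨hLm, ?_⟩
      have := norm_sub_norm_le (f^[k] z) (ratPoint (W (q, m, k)))
      rw [norm_sub_rev] at this
      have ht' : ‖ratPoint (W (q, m, k)) - f^[k] z‖ ≤ 1 := ht
      linarith
    show z ∈ ratBall (H (D n))
    rw [hn]
    simp only [H, hTt, cond_true, ratBall, Metric.mem_ball]
    rw [dist_comm, dist_eq_norm]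
    push_cast
    exact hq
  · rintro ⟨n, hn⟩ hzK
    change z ∈ ratBall (H (D n)) at hn
    generalize D n = x at hn
    obtain ⟨q, m, k⟩ := x
    simp only [H] at hn
    cases hTt : T (q, m, k) with
    | false => simp [hTt, ratBall] at hn
    | true =>
      simp only [hTt, cond_true, ratBall, Metric.mem_ball] at hn
      rw [dist_comm, dist_eq_norm] at hn
      push_cast at hn
      obtain ⟨h1, h2⟩ := (hTiff _).1 hTt
      have hb : ∀ j, ‖f^[j] z‖ ≤ R := fun j => hR _ (K_iterate f hzK j)
      have ht := track f (fun w => F (m, w)) (R + 2) ((1 / 2) ^ m) L hL1 (by positivity) (hstep m)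
        q z hn.le k h1.le (fun j _ => (hb j).trans (by linarith))
      have ht' : ‖ratPoint (W (q, m, k)) - f^[k] z‖ ≤ 1 := ht
      have h3 := norm_sub_norm_le (ratPoint (W (q, m, k))) (f^[k] z)
      have := hb k
      linarith
end
end

section
/- If P : ℂ → ℂ is a computable polynomial of degree ≥ 2, then its Julia set J(P) is lower computable, i.e., there is a uniformly computable sequence of points of J(P) that is dense in J(P). -/
open Complex Metric Set Filter Polynomial

noncomputable section

/-! ### Computability of rational arithmetic -/

theorem comp_find {α : Type*} [Primcodable α] {p : α → ℕ → Bool} (hp : Computable₂ p)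
    (h : ∀ a, ∃ n, p a n = true) : Computable fun a => Nat.find (h a) := by
  have h1 : Partrec fun a => Nat.rfind (fun n => Part.some (p a n)) := Partrec.rfind hp.partrec₂
  refine h1.of_eq_tot fun a => ?_
  refine Nat.mem_rfind.2 ⟨?_, fun {m} hm => ?_⟩
  · simpa using (Nat.find_spec (h a)).symm
  · have := Nat.find_min (h a) hm
    simpa using this

theorem comp_find' {α : Type*} [Primcodable α] {p : α → ℕ → Bool} (hp : Computable₂ p)
    (h : ∀ a, ∃ n, p a n = true) : ∃ f : α → ℕ, Computable f ∧ ∀ a, p a (f a) = true :=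
  ⟨_, comp_find hp h, fun a => Nat.find_spec (h a)⟩

section natops
variable {α : Type*} [Primcodable α]

theorem cadd {f g : α → ℕ} (hf : Computable f) (hg : Computable g) :
    Computable fun a => f a + g a := (Primrec.nat_add.to_comp).comp hf hg
theorem cmul {f g : α → ℕ} (hf : Computable f) (hg : Computable g) :
    Computable fun a => f a * g a := (Primrec.nat_mul.to_comp).comp hf hg
theorem csub {f g : α → ℕ} (hf : Computable f) (hg : Computable g) :
    Computable fun a => f a - g a := (Primrec.nat_sub.to_comp).comp hf hg
theorem cmod {f g : α → ℕ} (hf : Computable f) (hg : Computable g) :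
    Computable fun a => f a % g a := (Primrec.nat_mod.to_comp).comp hf hg
theorem cdiv {f g : α → ℕ} (hf : Computable f) (hg : Computable g) :
    Computable fun a => f a / g a := (Primrec.nat_div.to_comp).comp hf hg
theorem cand {f g : α → Bool} (hf : Computable f) (hg : Computable g) :
    Computable fun a => (f a && g a) := (Primrec.and.to_comp).comp hf hg
theorem cor {f g : α → Bool} (hf : Computable f) (hg : Computable g) :
    Computable fun a => (f a || g a) := (Primrec.or.to_comp).comp hf hg
theorem cnot {f : α → Bool} (hf : Computable f) :
    Computable fun a => (! f a) := (Primrec.not.to_comp).comp hf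
theorem ceqn {f g : α → ℕ} (hf : Computable f) (hg : Computable g) :
    Computable fun a => decide (f a = g a) := by
  have h : Computable₂ (fun a b : ℕ => decide (a = b)) := (Primrec.eq (α := ℕ)).decide.to_comp
  exact h.comp hf hg
theorem clen {f g : α → ℕ} (hf : Computable f) (hg : Computable g) :
    Computable fun a => decide (f a ≤ g a) := by
  have h : Computable₂ (fun a b : ℕ => decide (a ≤ b)) := Primrec.nat_le.decide.to_comp
  exact h.comp hf hg
theorem cltn {f g : α → ℕ} (hf : Computable f) (hg : Computable g) :
    Computable fun a => decide (f a < g a) := by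
  have h : Computable₂ (fun a b : ℕ => decide (a < b)) := Primrec.nat_lt.decide.to_comp
  exact h.comp hf hg

end natops

/-- Test used for deciding coprimality. -/
def copTest (x : ℕ × ℕ) (d : ℕ) : Bool :=
  (decide (2 ≤ d) && decide (x.1 % d = 0) && decide (x.2 % d = 0)) || decide (x.2 < d)

theorem cop_ex (x : ℕ × ℕ) : ∃ d, copTest x d = true := ⟨x.2 + 1, by simp [copTest]⟩

theorem comp_coprime : Computable fun x : ℕ × ℕ => decide (0 < x.2 ∧ Nat.Coprime x.1 x.2) := by
  have h1 : Computable fun x : ℕ × ℕ => Nat.find (cop_ex x) := by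
    refine comp_find (p := copTest) ?_ _
    refine Computable₂.mk ?_
    have a := Computable.fst.comp (Computable.fst (α := ℕ × ℕ) (β := ℕ))
    have b := Computable.snd.comp (Computable.fst (α := ℕ × ℕ) (β := ℕ))
    have d := Computable.snd (α := ℕ × ℕ) (β := ℕ)
    have z := Computable.const (α := (ℕ × ℕ) × ℕ) 0
    exact cor (cand (cand (clen (Computable.const 2) d) (ceqn (cmod a d) z)) (ceqn (cmod b d) z))
      (cltn b d)
  refine (cand (cltn (Computable.const 0) Computable.snd) (cltn Computable.snd h1)).of_eq ?_
  rintro ⟨a, b⟩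
  rw [← Bool.decide_and, decide_eq_decide]
  refine and_congr_right fun hb => ?_
  simp only at hb ⊢
  constructor
  · intro h
    by_contra hc
    have hg : 2 ≤ Nat.gcd a b := by
      have : 0 < Nat.gcd a b := Nat.gcd_pos_of_pos_right _ hb
      have h1 : Nat.gcd a b ≠ 1 := hc
      omega
    have h3 : Nat.find (cop_ex (a, b)) ≤ Nat.gcd a b := by
      refine Nat.find_min' _ ?_
      simp [copTest, hg, Nat.mod_eq_zero_of_dvd (Nat.gcd_dvd_left a b),
        Nat.mod_eq_zero_of_dvd (Nat.gcd_dvd_right a b)]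
    have h4 : Nat.gcd a b ≤ b := Nat.gcd_le_right _ hb
    omega
  · intro hc
    have h3 := Nat.find_spec (cop_ex (a, b))
    generalize Nat.find (cop_ex (a, b)) = d at h3 ⊢
    simp only [copTest, Bool.or_eq_true, Bool.and_eq_true, decide_eq_true_eq] at h3
    rcases h3 with ⟨⟨h2, ha⟩, hb'⟩ | h
    · exfalso
      have := Nat.dvd_gcd (Nat.dvd_of_mod_eq_zero ha) (Nat.dvd_of_mod_eq_zero hb')
      rw [hc.gcd_eq_one, Nat.dvd_one] at this
      omega
    · exact h

/-- The original (sparse) coding of the rationals. -/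
def oldEnc (q : ℚ) : ℕ := @Encodable.encode ℚ Rat.instEncodable q

theorem oldEnc_eq (q : ℚ) : oldEnc q = Nat.pair (Encodable.encode q.num) q.den := rfl

theorem encInt_nat (n : ℕ) : Encodable.encode (n : ℤ) = 2 * n := rfl
theorem encInt_neg (n : ℕ) : Encodable.encode (Int.negSucc n) = 2 * n + 1 := rfl

theorem encInt_natAbs (z : ℤ) : (Encodable.encode z + 1) / 2 = z.natAbs := by
  cases z with
  | ofNat n => rw [Int.ofNat_eq_natCast, encInt_nat]; simp; omega
  | negSucc n => rw [encInt_neg]; simp; omega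

theorem mem_range_oldEnc (m : ℕ) : m ∈ Set.range oldEnc ↔
    0 < m.unpair.2 ∧ Nat.Coprime ((m.unpair.1 + 1) / 2) m.unpair.2 := by
  constructor
  · rintro ⟨q, rfl⟩
    rw [oldEnc_eq, Nat.unpair_pair]
    simp only [encInt_natAbs]
    exact ⟨q.den_pos, q.reduced⟩
  · rintro ⟨h1, h2⟩
    have hz : Encodable.encode (Denumerable.ofNat ℤ m.unpair.1) = m.unpair.1 := Denumerable.encode_ofNat _
    refine ⟨⟨Denumerable.ofNat ℤ m.unpair.1, m.unpair.2, h1.ne', ?_⟩, ?_⟩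
    · rw [← encInt_natAbs, hz]; exact h2
    · rw [oldEnc_eq]
      simp only [hz, Nat.pair_unpair]

theorem infRange : Infinite (Set.range (@Encodable.encode ℚ Rat.instEncodable)) :=
  Infinite.of_injective _
    (Equiv.ofInjective _ (@Encodable.encode_injective ℚ Rat.instEncodable)).injective

theorem oldEnc_ofNat (n : ℕ) :
    let _ := @Encodable.decidableRangeEncode ℚ Rat.instEncodable
    have := infRange
    oldEnc (Denumerable.ofNat ℚ n) =
      (Nat.Subtype.ofNat (Set.range (@Encodable.encode ℚ Rat.instEncodable)) n : ℕ) := by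
  let _ := @Encodable.decidableRangeEncode ℚ Rat.instEncodable
  have := infRange
  have : Denumerable.ofNat ℚ n = (@Encodable.equivRangeEncode ℚ Rat.instEncodable).symm
      (Nat.Subtype.ofNat (Set.range (@Encodable.encode ℚ Rat.instEncodable)) n) := by
    with_unfolding_all rfl
  have h2 := (@Encodable.equivRangeEncode ℚ Rat.instEncodable).apply_symm_apply
    (Nat.Subtype.ofNat (Set.range (@Encodable.encode ℚ Rat.instEncodable)) n)
  rw [this]
  exact congrArg Subtype.val h2

/-- Boolean test for being an original code of a rational. -/
def inS (m : ℕ) : Bool := decide (0 < m.unpair.2 ∧ Nat.Coprime ((m.unpair.1 + 1) / 2) m.unpair.2)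

theorem inS_iff (m : ℕ) : inS m = true ↔ m ∈ Set.range oldEnc := by
  rw [mem_range_oldEnc, inS, decide_eq_true_eq]

theorem comp_inS : Computable inS := by
  have a := Computable.fst.comp Computable.unpair
  have b := Computable.snd.comp Computable.unpair
  exact comp_coprime.comp
    ((cdiv (cadd a (Computable.const 1)) (Computable.const 2)).pair b)

theorem next_ex (x : ℕ) : ∃ n, inS (x + n + 1) = true := by
  by_contra hc
  push Not at hc
  have : (Set.range oldEnc) ⊆ Set.Iic x := by
    intro y hy
    by_contra hxy
    simp only [Set.mem_Iic, not_le] at hxy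
    apply hc (y - x - 1)
    rw [inS_iff]
    convert hy using 1
    omega
  have h2 : (Set.range oldEnc).Finite := (Set.finite_Iic x).subset this
  exact Set.infinite_coe_iff.mp infRange h2

theorem oldEnc_ofNat_succ (n : ℕ) : oldEnc (Denumerable.ofNat ℚ (n + 1)) =
    oldEnc (Denumerable.ofNat ℚ n) + Nat.find (next_ex (oldEnc (Denumerable.ofNat ℚ n))) + 1 := by
  let _ := @Encodable.decidableRangeEncode ℚ Rat.instEncodable
  have := infRange
  have h1 := oldEnc_ofNat (n + 1)
  have h0 := oldEnc_ofNat n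
  simp only [Nat.Subtype.ofNat, Nat.Subtype.succ] at h1
  rw [h1, h0]
  congr 2
  refine Nat.find_congr' ?_
  intro k
  rw [inS_iff]
  rfl

theorem comp_oldEnc_ofNat : Computable fun n => oldEnc (Denumerable.ofNat ℚ n) := by
  have hn : Computable fun x : ℕ => Nat.find (next_ex x) := by
    refine comp_find (p := fun x n => inS (x + n + 1)) ?_ _
    refine Computable₂.mk ?_
    exact comp_inS.comp (cadd (cadd Computable.fst Computable.snd) (Computable.const 1))
  have hstep : Computable fun x : ℕ => x + Nat.find (next_ex x) + 1 :=
    cadd (cadd Computable.id hn) (Computable.const 1)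
  have := Computable.nat_rec (α := ℕ) (σ := ℕ) (f := fun n => n)
    (g := fun _ => oldEnc (Denumerable.ofNat ℚ 0))
    (h := fun _ x => x.2 + Nat.find (next_ex x.2) + 1) Computable.id (Computable.const _)
    (Computable₂.mk (hstep.comp (Computable.snd.comp Computable.snd)))
  refine this.of_eq fun n => ?_
  induction n with
  | zero => rfl
  | succ k ih =>
    rw [oldEnc_ofNat_succ]
    simp only at ih ⊢
    rw [ih]

theorem comp_oldEnc : Computable oldEnc := by
  refine (comp_oldEnc_ofNat.comp (Computable.encode (α := ℚ))).of_eq fun q => ?_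
  congr 1
  exact Denumerable.ofNat_encode q

theorem comp_den : Computable Rat.den :=
  (Computable.snd.comp (Computable.unpair.comp comp_oldEnc)).of_eq fun q => by
    rw [oldEnc_eq, Nat.unpair_pair]

theorem comp_encnum : Computable fun q : ℚ => Encodable.encode q.num :=
  (Computable.fst.comp (Computable.unpair.comp comp_oldEnc)).of_eq fun q => by
    rw [oldEnc_eq, Nat.unpair_pair]

/-- Positive part of the numerator. -/
def qp (q : ℚ) : ℕ := q.num.toNat
/-- Negative part of the numerator. -/
def qm (q : ℚ) : ℕ := (-q.num).toNat

theorem comp_qp : Computable qp := by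
  have h := Computable.cond (ceqn (cmod comp_encnum (Computable.const 2)) (Computable.const 0))
    (cdiv comp_encnum (Computable.const 2)) (Computable.const 0)
  refine h.of_eq fun q => ?_
  rw [qp]
  rcases q.num with n | n
  · rw [Int.ofNat_eq_natCast, encInt_nat]; simp
  · rw [encInt_neg]; simp [Nat.add_mod]

theorem comp_qm : Computable qm := by
  have h := Computable.cond (ceqn (cmod comp_encnum (Computable.const 2)) (Computable.const 0))
    (Computable.const 0) (cdiv (cadd comp_encnum (Computable.const 1)) (Computable.const 2))
  refine h.of_eq fun q => ?_
  rw [qm]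
  rcases q.num with n | n
  · rw [Int.ofNat_eq_natCast, encInt_nat]; simp
  · rw [encInt_neg]
    have h1 : (2 * n + 1) % 2 = 1 := by omega
    have h2 : (2 * n + 1 + 1) / 2 = n + 1 := by omega
    simp [h1, h2, Int.neg_negSucc]

theorem q_eq (q : ℚ) : q = ((qp q : ℚ) - qm q) / q.den := by
  have : ((qp q : ℤ) - qm q) = q.num := by
    simp only [qp, qm]; omega
  conv_lhs => rw [← Rat.num_div_den q, ← this]
  push_cast
  rfl

/-- Rational from a natural triple. -/
def mkQ (t : ℕ × ℕ × ℕ) : ℚ := ((t.1 : ℚ) - t.2.1) / ((t.2.2 : ℚ) + 1)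

theorem mkQ_eq_iff (t : ℕ × ℕ × ℕ) (q : ℚ) : mkQ t = q ↔
    t.1 * q.den + qm q * (t.2.2 + 1) = qp q * (t.2.2 + 1) + t.2.1 * q.den := by
  have h1 : (q.den : ℚ) ≠ 0 := by exact_mod_cast q.den_nz
  have h2 : (t.2.2 : ℚ) + 1 ≠ 0 := by positivity
  conv_lhs => rw [q_eq q]
  rw [mkQ, div_eq_div_iff h2 h1, ← @Nat.cast_inj ℚ]
  push_cast
  constructor <;> intro h <;> linarith

/-- Test used for computing `mkQ`. -/
def mkTest (t : ℕ × ℕ × ℕ) (q : ℚ) : Bool :=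
  decide (t.1 * q.den + qm q * (t.2.2 + 1) = qp q * (t.2.2 + 1) + t.2.1 * q.den)

theorem mkTest_iff (t : ℕ × ℕ × ℕ) (q : ℚ) : mkTest t q = true ↔ mkQ t = q := by
  rw [mkTest, decide_eq_true_eq, mkQ_eq_iff]

theorem mkQ_ex (t : ℕ × ℕ × ℕ) : ∃ n, mkTest t (Denumerable.ofNat ℚ n) = true := by
  refine ⟨Denumerable.eqv ℚ (mkQ t), ?_⟩
  rw [mkTest_iff]
  exact (Denumerable.ofNat_encode _).symm

theorem comp_mkTest : Computable₂ mkTest := by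
  refine Computable₂.mk ?_
  have q := (Computable.snd (α := ℕ × ℕ × ℕ) (β := ℚ))
  have t := (Computable.fst (α := ℕ × ℕ × ℕ) (β := ℚ))
  have t1 := Computable.fst.comp t
  have t2 := Computable.fst.comp (Computable.snd.comp t)
  have t3 := cadd (Computable.snd.comp (Computable.snd.comp t)) (Computable.const 1)
  exact (ceqn (cadd (cmul t1 (comp_den.comp q))
    (cmul (comp_qm.comp q) t3)) (cadd (cmul (comp_qp.comp q) t3) (cmul t2 (comp_den.comp q))))

theorem comp_mkQ : Computable mkQ := by
  have h0 : Computable fun p : (ℕ × ℕ × ℕ) × ℕ => Denumerable.ofNat ℚ p.2 :=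
    (Computable.ofNat ℚ).comp Computable.snd
  have h2 : Computable fun p : (ℕ × ℕ × ℕ) × ℕ => mkTest p.1 (Denumerable.ofNat ℚ p.2) :=
    comp_mkTest.comp Computable.fst h0
  obtain ⟨f, hf, hs⟩ := comp_find' (p := fun t n => mkTest t (Denumerable.ofNat ℚ n))
    (Computable₂.mk h2) mkQ_ex
  refine Computable.of_eq (f := fun t => Denumerable.ofNat ℚ (f t))
    ((Computable.ofNat ℚ).comp hf) fun t => ?_
  exact ((mkTest_iff _ _).1 (hs t)).symm

section qops
variable {α : Type*} [Primcodable α]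

theorem qadd {f g : α → ℚ} (hf : Computable f) (hg : Computable g) :
    Computable fun a => f a + g a := by
  have fp := comp_qp.comp hf
  have fm := comp_qm.comp hf
  have fd := comp_den.comp hf
  have gp := comp_qp.comp hg
  have gm := comp_qm.comp hg
  have gd := comp_den.comp hg
  refine (comp_mkQ.comp ((cadd (cmul fp gd) (cmul gp fd)).pair
    ((cadd (cmul fm gd) (cmul gm fd)).pair
    (csub (cmul fd gd) (Computable.const 1))))).of_eq fun a => ?_
  have h1 : ((f a).den : ℚ) ≠ 0 := by exact_mod_cast (f a).den_nz
  have h2 : ((g a).den : ℚ) ≠ 0 := by exact_mod_cast (g a).den_nz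
  have h3 : 1 ≤ (f a).den * (g a).den := Nat.mul_pos (f a).den_pos (g a).den_pos
  conv_rhs => rw [q_eq (f a), q_eq (g a)]
  simp only [mkQ]
  push_cast [Nat.cast_sub h3]
  rw [sub_add_cancel]
  field_simp
  ring

theorem qmul {f g : α → ℚ} (hf : Computable f) (hg : Computable g) :
    Computable fun a => f a * g a := by
  have fp := comp_qp.comp hf
  have fm := comp_qm.comp hf
  have fd := comp_den.comp hf
  have gp := comp_qp.comp hg
  have gm := comp_qm.comp hg
  have gd := comp_den.comp hg
  refine (comp_mkQ.comp ((cadd (cmul fp gp) (cmul fm gm)).pair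
    ((cadd (cmul fp gm) (cmul fm gp)).pair
    (csub (cmul fd gd) (Computable.const 1))))).of_eq fun a => ?_
  have h1 : ((f a).den : ℚ) ≠ 0 := by exact_mod_cast (f a).den_nz
  have h2 : ((g a).den : ℚ) ≠ 0 := by exact_mod_cast (g a).den_nz
  have h3 : 1 ≤ (f a).den * (g a).den := Nat.mul_pos (f a).den_pos (g a).den_pos
  conv_rhs => rw [q_eq (f a), q_eq (g a)]
  simp only [mkQ]
  push_cast [Nat.cast_sub h3]
  rw [sub_add_cancel]
  field_simp
  ring

theorem qsub {f g : α → ℚ} (hf : Computable f) (hg : Computable g) :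
    Computable fun a => f a - g a :=
  (qadd hf (qmul (Computable.const (-1)) hg)).of_eq fun a => by ring

theorem qle {f g : α → ℚ} (hf : Computable f) (hg : Computable g) :
    Computable fun a => decide (f a ≤ g a) := by
  have fp := comp_qp.comp hf
  have fm := comp_qm.comp hf
  have fd := comp_den.comp hf
  have gp := comp_qp.comp hg
  have gm := comp_qm.comp hg
  have gd := comp_den.comp hg
  refine (clen (cadd (cmul fp gd) (cmul gm fd)) (cadd (cmul gp fd) (cmul fm gd))).of_eq fun a => ?_
  have h1 : (0 : ℚ) < ((f a).den : ℚ) := by exact_mod_cast (f a).den_pos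
  have h2 : (0 : ℚ) < ((g a).den : ℚ) := by exact_mod_cast (g a).den_pos
  rw [decide_eq_decide]
  conv_rhs => rw [q_eq (f a), q_eq (g a)]
  rw [div_le_div_iff₀ h1 h2, ← @Nat.cast_le ℚ]
  push_cast
  constructor <;> intro h <;> linarith

theorem qlt {f g : α → ℚ} (hf : Computable f) (hg : Computable g) :
    Computable fun a => decide (f a < g a) :=
  (cnot (qle hg hf)).of_eq fun a => by
    rw [← decide_not, decide_eq_decide, not_le]

theorem qabs {f : α → ℚ} (hf : Computable f) : Computable fun a => |f a| := by
  refine (Computable.cond (qle (Computable.const 0) hf) hf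
    (qmul (Computable.const (-1)) hf)).of_eq fun a => ?_
  by_cases h : 0 ≤ f a
  · simp [h, abs_of_nonneg h]
  · simp [h, abs_of_nonpos (not_le.mp h).le]

theorem qpow {f : α → ℚ} {e : α → ℕ} (hf : Computable f) (he : Computable e) :
    Computable fun a => f a ^ e a := by
  have := Computable.nat_rec (α := α) (σ := ℚ) (f := e) (g := fun _ => 1)
    (h := fun a x => x.2 * f a) he (Computable.const _)
    (Computable₂.mk (qmul (Computable.snd.comp Computable.snd) (hf.comp Computable.fst)))
  refine this.of_eq fun a => ?_
  induction e a with
  | zero => simp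
  | succ k ih => simp only at ih ⊢; rw [ih, pow_succ]

theorem cpow {f : α → ℕ} {e : α → ℕ} (hf : Computable f) (he : Computable e) :
    Computable fun a => f a ^ e a := by
  have := Computable.nat_rec (α := α) (σ := ℕ) (f := e) (g := fun _ => 1)
    (h := fun a x => x.2 * f a) he (Computable.const _)
    (Computable₂.mk (cmul (Computable.snd.comp Computable.snd) (hf.comp Computable.fst)))
  refine this.of_eq fun a => ?_
  induction e a with
  | zero => simp
  | succ k ih => simp only at ih ⊢; rw [ih, pow_succ]

end qops

/-! ### Ball arithmetic -/

/-- `z` lies in the closed rational ball coded by `b`. -/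
def inB (b : ℚ × ℚ × ℚ) (z : ℂ) : Prop := ‖z - ratPoint (b.1, b.2.1)‖ ≤ (b.2.2 : ℝ)

/-- The 1-norm of a rational point. -/
def nrm (x y : ℚ) : ℚ := |x| + |y|

theorem norm_ratPoint_le (x y : ℚ) : ‖ratPoint (x, y)‖ ≤ (nrm x y : ℝ) := by
  have := Complex.norm_le_abs_re_add_abs_im (ratPoint (x, y))
  simpa [ratPoint, nrm] using this

theorem nrm_le (x y : ℚ) : (nrm x y : ℝ) ≤ 2 * ‖ratPoint (x, y)‖ := by
  have h1 := Complex.abs_re_le_norm (ratPoint (x, y))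
  have h2 := Complex.abs_im_le_norm (ratPoint (x, y))
  simp only [ratPoint] at h1 h2 ⊢
  simp only [nrm]
  push_cast
  linarith

theorem ratPoint_sub (x y u v : ℚ) : ratPoint (x, y) - ratPoint (u, v) = ratPoint (x - u, y - v) := by
  apply Complex.ext <;> simp [ratPoint]

theorem ratPoint_add (x y u v : ℚ) : ratPoint (x, y) + ratPoint (u, v) = ratPoint (x + u, y + v) := by
  apply Complex.ext <;> simp [ratPoint]

theorem ratPoint_mul (x y u v : ℚ) :
    ratPoint (x, y) * ratPoint (u, v) = ratPoint (x * u - y * v, x * v + y * u) := by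
  apply Complex.ext <;> simp [ratPoint]

/-- Sum of balls. -/
def badd (a b : ℚ × ℚ × ℚ) : ℚ × ℚ × ℚ := (a.1 + b.1, a.2.1 + b.2.1, a.2.2 + b.2.2)
/-- Product of balls. -/
def bmul (a b : ℚ × ℚ × ℚ) : ℚ × ℚ × ℚ :=
  (a.1 * b.1 - a.2.1 * b.2.1, a.1 * b.2.1 + a.2.1 * b.1,
    nrm a.1 a.2.1 * b.2.2 + nrm b.1 b.2.1 * a.2.2 + a.2.2 * b.2.2)

theorem inB_add {a b : ℚ × ℚ × ℚ} {z w : ℂ} (ha : inB a z) (hb : inB b w) :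
    inB (badd a b) (z + w) := by
  simp only [inB, badd] at *
  rw [← ratPoint_add]
  push_cast
  calc _ = ‖(z - ratPoint (a.1, a.2.1)) + (w - ratPoint (b.1, b.2.1))‖ := by congr 1; ring
    _ ≤ _ := (norm_add_le _ _).trans (add_le_add ha hb)

theorem inB_mul {a b : ℚ × ℚ × ℚ} {z w : ℂ} (ha : inB a z) (hb : inB b w) :
    inB (bmul a b) (z * w) := by
  simp only [inB, bmul] at *
  rw [← ratPoint_mul]
  have ea := norm_ratPoint_le a.1 a.2.1
  have eb := norm_ratPoint_le b.1 b.2.1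
  set A := ratPoint (a.1, a.2.1)
  set B := ratPoint (b.1, b.2.1)
  push_cast
  calc _ = ‖A * (w - B) + B * (z - A) + (z - A) * (w - B)‖ := by congr 1; ring
    _ ≤ ‖A * (w - B)‖ + ‖B * (z - A)‖ + ‖(z - A) * (w - B)‖ := norm_add₃_le
    _ = ‖A‖ * ‖w - B‖ + ‖B‖ * ‖z - A‖ + ‖z - A‖ * ‖w - B‖ := by simp only [norm_mul]
    _ ≤ _ := by
      have := norm_nonneg A
      have := norm_nonneg B
      have := norm_nonneg (z - A)
      have := norm_nonneg (w - B)
      gcongr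
      all_goals first | assumption | linarith

/-- `F` can be evaluated by computable ball arithmetic. -/
def IC (F : ℂ → ℂ) : Prop :=
  ∃ Φ : ℚ × ℚ × ℚ → ℕ → ℚ × ℚ × ℚ, Computable₂ Φ ∧
    (∀ z b k, inB b z → inB (Φ b k) (F z)) ∧
    (∀ z (b : ℕ → ℚ × ℚ × ℚ), (∀ k, inB (b k) z) →
      Tendsto (fun k => ((b k).2.2 : ℝ)) atTop (nhds 0) →
      Tendsto (fun k => ((Φ (b k) k).2.2 : ℝ)) atTop (nhds 0))

theorem IC_id : IC (fun z => z) := ⟨fun b _ => b, Computable.fst, fun _ _ _ h => h, fun _ _ _ h => h⟩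

theorem IC_const {w : ℂ} (hw : ComputableComplex w) : IC (fun _ => w) := by
  obtain ⟨⟨g, hg, hg'⟩, ⟨h, hh, hh'⟩⟩ := hw
  refine ⟨fun _ k => (g k, h k, 2 * (1 / 2) ^ k), ?_, ?_, ?_⟩
  · refine Computable₂.mk ((hg.comp Computable.snd).pair ((hh.comp Computable.snd).pair ?_))
    exact qmul (Computable.const _) (qpow (Computable.const _) Computable.snd)
  · intro z b k _
    simp only [inB]
    have h1 := (hg' k).le
    have h2 := (hh' k).le
    have h3 := Complex.norm_le_abs_re_add_abs_im (w - ratPoint (g k, h k))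
    simp only [ratPoint, Complex.sub_re, Complex.sub_im] at h3 ⊢
    rw [abs_sub_comm] at h1 h2
    push_cast
    linarith
  · intro z b _ _
    have : Tendsto (fun k : ℕ => 2 * (1 / 2 : ℝ) ^ k) atTop (nhds (2 * 0)) :=
      (tendsto_pow_atTop_nhds_zero_of_lt_one (by norm_num) (by norm_num)).const_mul 2
    simpa using this

section
variable {α : Type*} [Primcodable α] {f g : α → ℚ × ℚ × ℚ}

theorem c1 (hf : Computable f) : Computable fun a => (f a).1 := Computable.fst.comp hf
theorem c2 (hf : Computable f) : Computable fun a => (f a).2.1 :=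
  Computable.fst.comp (Computable.snd.comp hf)
theorem c3 (hf : Computable f) : Computable fun a => (f a).2.2 :=
  Computable.snd.comp (Computable.snd.comp hf)

theorem comp_nrm {u v : α → ℚ} (hu : Computable u) (hv : Computable v) :
    Computable fun a => nrm (u a) (v a) := qadd (qabs hu) (qabs hv)

theorem comp_badd (hf : Computable f) (hg : Computable g) :
    Computable fun a => badd (f a) (g a) :=
  (qadd (c1 hf) (c1 hg)).pair ((qadd (c2 hf) (c2 hg)).pair (qadd (c3 hf) (c3 hg)))

theorem comp_bmul (hf : Computable f) (hg : Computable g) :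
    Computable fun a => bmul (f a) (g a) := by
  have h1 := qsub (qmul (c1 hf) (c1 hg)) (qmul (c2 hf) (c2 hg))
  have h2 := qadd (qmul (c1 hf) (c2 hg)) (qmul (c2 hf) (c1 hg))
  have h3 := qadd (qadd (qmul (comp_nrm (c1 hf) (c2 hf)) (c3 hg))
    (qmul (comp_nrm (c1 hg) (c2 hg)) (c3 hf))) (qmul (c3 hf) (c3 hg))
  exact h1.pair (h2.pair h3)
end

theorem IC_add {F G : ℂ → ℂ} (hF : IC F) (hG : IC G) : IC (fun z => F z + G z) := by
  obtain ⟨Φ, h1, h2, h3⟩ := hF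
  obtain ⟨Ψ, g1, g2, g3⟩ := hG
  refine ⟨fun b k => badd (Φ b k) (Ψ b k), Computable₂.mk (comp_badd h1 g1), ?_, ?_⟩
  · exact fun z b k hb => inB_add (h2 z b k hb) (g2 z b k hb)
  · intro z b hb ht
    have := (h3 z b hb ht).add (g3 z b hb ht)
    simpa [badd] using this

theorem nrm_tendsto {z : ℂ} {b : ℕ → ℚ × ℚ × ℚ} (hb : ∀ k, inB (b k) z)
    (ht : Tendsto (fun k => ((b k).2.2 : ℝ)) atTop (nhds 0)) :
    Tendsto (fun k => (nrm (b k).1 (b k).2.1 : ℝ)) atTop (nhds (|z.re| + |z.im|)) := by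
  have h1 : Tendsto (fun k => ratPoint ((b k).1, (b k).2.1)) atTop (nhds z) := by
    rw [tendsto_iff_dist_tendsto_zero]
    refine squeeze_zero (fun _ => dist_nonneg) (fun k => ?_) ht
    rw [dist_comm, dist_eq_norm]
    exact hb k
  have h2 := ((Complex.continuous_re.tendsto z).comp h1).abs
  have h3 := ((Complex.continuous_im.tendsto z).comp h1).abs
  have := h2.add h3
  simpa [nrm, ratPoint, Function.comp_def] using this

theorem IC_mul {F G : ℂ → ℂ} (hF : IC F) (hG : IC G) : IC (fun z => F z * G z) := by
  obtain ⟨Φ, h1, h2, h3⟩ := hF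
  obtain ⟨Ψ, g1, g2, g3⟩ := hG
  refine ⟨fun b k => bmul (Φ b k) (Ψ b k), Computable₂.mk (comp_bmul h1 g1), ?_, ?_⟩
  · exact fun z b k hb => inB_mul (h2 z b k hb) (g2 z b k hb)
  · intro z b hb ht
    have t1 := h3 z b hb ht
    have t2 := g3 z b hb ht
    have n1 := nrm_tendsto (fun k => h2 z _ k (hb k)) t1
    have n2 := nrm_tendsto (fun k => g2 z _ k (hb k)) t2
    have := ((n1.mul t2).add (n2.mul t1)).add (t1.mul t2)
    simpa [bmul] using this

theorem IC_poly (P : Polynomial ℂ) (hP : ∀ i : ℕ, ComputableComplex (P.coeff i)) :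
    IC (fun z => P.eval z) := by
  have hz : IC (fun _ => (0 : ℂ)) := IC_const (by
    have h0 : ComputableReal 0 := ⟨fun _ => 0, Computable.const _, fun n => by simp⟩
    exact ⟨h0, h0⟩)
  have ho : IC (fun _ => (1 : ℂ)) := IC_const (by
    refine ⟨⟨fun _ => 1, Computable.const _, fun n => by simp⟩,
      ⟨fun _ => 0, Computable.const _, fun n => by simp⟩⟩)
  have hpow : ∀ n : ℕ, IC (fun z => z ^ n) := by
    intro n
    induction n with
    | zero => simpa using ho
    | succ k ih => simpa [pow_succ] using IC_mul ih IC_id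
  have hsum : ∀ n : ℕ, IC (fun z => ∑ i ∈ Finset.range n, P.coeff i * z ^ i) := by
    intro n
    induction n with
    | zero => simpa using hz
    | succ k ih =>
      simp only [Finset.sum_range_succ]
      exact IC_add ih (IC_mul (IC_const (hP k)) (hpow k))
  have := hsum (P.natDegree + 1)
  simpa only [Polynomial.eval_eq_sum_range] using this

/-- Iterating a ball map with fixed precision. -/
def iterBall (Φ : ℚ × ℚ × ℚ → ℕ → ℚ × ℚ × ℚ) (x : ℕ × (ℚ × ℚ) × ℕ) : ℚ × ℚ × ℚ :=
  Nat.rec (motive := fun _ => ℚ × ℚ × ℚ) (x.2.1.1, x.2.1.2, 0) (fun _ β => Φ β x.2.2) x.1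

theorem comp_iterBall {Φ : ℚ × ℚ × ℚ → ℕ → ℚ × ℚ × ℚ} (hΦ : Computable₂ Φ) :
    Computable (iterBall Φ) := by
  have hc : Computable fun x : ℕ × (ℚ × ℚ) × ℕ => x.2.1 := Computable.fst.comp Computable.snd
  have hk : Computable fun x : ℕ × (ℚ × ℚ) × ℕ => x.2.2 := Computable.snd.comp Computable.snd
  have hx : Computable fun x : ℕ × (ℚ × ℚ) × ℕ => x.2.1.1 := Computable.fst.comp hc
  have hy : Computable fun x : ℕ × (ℚ × ℚ) × ℕ => x.2.1.2 := Computable.snd.comp hc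
  have h0 : Computable fun x : ℕ × (ℚ × ℚ) × ℕ => ((x.2.1.1, x.2.1.2, 0) : ℚ × ℚ × ℚ) :=
    hx.pair (hy.pair (Computable.const 0))
  have hk' : Computable fun p : (ℕ × (ℚ × ℚ) × ℕ) × (ℕ × (ℚ × ℚ × ℚ)) => p.1.2.2 :=
    hk.comp Computable.fst
  have hb : Computable fun p : (ℕ × (ℚ × ℚ) × ℕ) × (ℕ × (ℚ × ℚ × ℚ)) => p.2.2 :=
    Computable.snd.comp Computable.snd
  have h1 : Computable₂ fun (x : ℕ × (ℚ × ℚ) × ℕ) (p : ℕ × (ℚ × ℚ × ℚ)) => Φ p.2 x.2.2 :=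
    Computable₂.mk (hΦ.comp hb hk')
  exact (Computable.nat_rec (f := fun x : ℕ × (ℚ × ℚ) × ℕ => x.1) Computable.fst h0 h1).of_eq
    fun x => rfl

/-- Ball enclosures of all iterates of a function. -/
theorem IC_iter {F : ℂ → ℂ} (hF : IC F) :
    ∃ Θ : ℕ × (ℚ × ℚ) × ℕ → ℚ × ℚ × ℚ, Computable Θ ∧
      (∀ n c k, inB (Θ (n, c, k)) (F^[n] (ratPoint c))) ∧
      (∀ n c, Tendsto (fun k => ((Θ (n, c, k)).2.2 : ℝ)) atTop (nhds 0)) := by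
  obtain ⟨Φ, h1, h2, h3⟩ := hF
  let Θ : ℕ × (ℚ × ℚ) × ℕ → ℚ × ℚ × ℚ := iterBall Φ
  have hs : ∀ n c k, inB (Θ (n, c, k)) (F^[n] (ratPoint c)) := by
    intro n c k
    induction n with
    | zero => simp [Θ, inB, iterBall]
    | succ m ih =>
      rw [Function.iterate_succ_apply']
      exact h2 _ _ _ ih
  refine ⟨Θ, ?_, hs, ?_⟩
  · exact comp_iterBall h1
  · intro n c
    induction n with
    | zero => simp [Θ, iterBall]
    | succ m ih => exact h3 (F^[m] (ratPoint c)) (fun k => Θ (m, c, k)) (fun k => hs m c k) ih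

/-! ### Dynamics near infinity -/

theorem exists_lower (P : Polynomial ℂ) (hdeg : 2 ≤ P.natDegree) :
    ∃ κ R : ℝ, 0 < κ ∧ κ ≤ 1 ∧ 1 ≤ R ∧ 2 ≤ κ * R ∧
      ∀ w : ℂ, R ≤ ‖w‖ → κ * ‖w‖ ^ P.natDegree ≤ ‖P.eval w‖ := by
  have hP0 : P ≠ 0 := by rintro rfl; simp at hdeg
  obtain ⟨e, he⟩ : ∃ e, P.natDegree = e + 1 := ⟨P.natDegree - 1, by omega⟩
  set L := ‖P.leadingCoeff‖ with hL
  have hLpos : 0 < L := by simpa [hL] using hP0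
  set S := ∑ i ∈ Finset.range (e + 1), ‖P.coeff i‖ with hS
  have hS0 : 0 ≤ S := Finset.sum_nonneg fun _ _ => norm_nonneg _
  set κ := min 1 (L / 2) with hκ
  have hκpos : 0 < κ := lt_min one_pos (by positivity)
  refine ⟨κ, max (max 1 (2 / κ)) (2 * S / L), hκpos, min_le_left _ _, ?_, ?_, ?_⟩
  · exact (le_max_left _ _).trans (le_max_left _ _)
  · have : 2 / κ ≤ max (max 1 (2 / κ)) (2 * S / L) := (le_max_right _ _).trans (le_max_left _ _)
    rwa [div_le_iff₀' hκpos] at this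
  · intro w hw
    have h1 : 1 ≤ ‖w‖ := ((le_max_left _ _).trans (le_max_left _ _)).trans hw
    have h2 : 2 * S / L ≤ ‖w‖ := (le_max_right _ _).trans hw
    rw [div_le_iff₀ hLpos] at h2
    have hev : P.eval w = ∑ i ∈ Finset.range (e + 1), P.coeff i * w ^ i
        + P.leadingCoeff * w ^ (e + 1) := by
      rw [eval_eq_sum_range, he, Finset.sum_range_succ, ← he]; rfl
    have hsum : ‖∑ i ∈ Finset.range (e + 1), P.coeff i * w ^ i‖ ≤ S * ‖w‖ ^ e := by
      refine (norm_sum_le _ _).trans ?_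
      rw [hS, Finset.sum_mul]
      refine Finset.sum_le_sum fun i hi => ?_
      rw [norm_mul, norm_pow]
      refine mul_le_mul_of_nonneg_left (pow_le_pow_right₀ h1 ?_) (norm_nonneg _)
      have := Finset.mem_range.1 hi; omega
    have hlead : ‖P.leadingCoeff * w ^ (e + 1)‖ = L * ‖w‖ ^ (e + 1) := by
      rw [norm_mul, norm_pow]
    have htri : L * ‖w‖ ^ (e + 1) - S * ‖w‖ ^ e ≤ ‖P.eval w‖ := by
      rw [hev]
      have h := norm_sub_le (∑ i ∈ Finset.range (e + 1), P.coeff i * w ^ i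
        + P.leadingCoeff * w ^ (e + 1)) (∑ i ∈ Finset.range (e + 1), P.coeff i * w ^ i)
      rw [add_sub_cancel_left, hlead] at h
      linarith
    have hpe : 0 ≤ ‖w‖ ^ e := by positivity
    have hk2 : κ ≤ L / 2 := min_le_right _ _
    rw [he]
    rw [pow_succ] at htri ⊢
    have h3 : κ * (‖w‖ ^ e * ‖w‖) ≤ L / 2 * (‖w‖ ^ e * ‖w‖) :=
      mul_le_mul_of_nonneg_right hk2 (by positivity)
    have h4 := mul_le_mul_of_nonneg_left h2 hpe
    nlinarith

theorem exists_upper (P : Polynomial ℂ) :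
    ∃ C : ℝ, 1 ≤ C ∧ ∀ w : ℂ, max 1 ‖P.eval w‖ ≤ C * (max 1 ‖w‖) ^ P.natDegree := by
  refine ⟨1 + ∑ i ∈ Finset.range (P.natDegree + 1), ‖P.coeff i‖, ?_, ?_⟩
  · have : 0 ≤ ∑ i ∈ Finset.range (P.natDegree + 1), ‖P.coeff i‖ :=
      Finset.sum_nonneg fun _ _ => norm_nonneg _
    linarith
  · intro w
    have h1 : 1 ≤ max 1 ‖w‖ := le_max_left _ _
    have hp : 1 ≤ (max 1 ‖w‖) ^ P.natDegree := one_le_pow₀ h1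
    have hS0 : 0 ≤ ∑ i ∈ Finset.range (P.natDegree + 1), ‖P.coeff i‖ :=
      Finset.sum_nonneg fun _ _ => norm_nonneg _
    refine max_le ?_ ?_
    · nlinarith
    · rw [eval_eq_sum_range]
      refine (norm_sum_le _ _).trans ?_
      rw [add_mul, Finset.sum_mul]
      refine le_trans ?_ (le_add_of_nonneg_left (by positivity))
      refine Finset.sum_le_sum fun i hi => ?_
      rw [norm_mul, norm_pow]
      refine mul_le_mul_of_nonneg_left ?_ (norm_nonneg _)
      refine (pow_le_pow_left₀ (norm_nonneg _) (le_max_right 1 _) i).trans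
        (pow_le_pow_right₀ h1 ?_)
      have := Finset.mem_range.1 hi; omega

theorem iter_upper (P : Polynomial ℂ) (hdeg : 2 ≤ P.natDegree) :
    ∃ C : ℝ, 1 ≤ C ∧ ∀ (n : ℕ) (w : ℂ),
      C * max 1 ‖(fun z => P.eval z)^[n] w‖ ≤ (C * max 1 ‖w‖) ^ (P.natDegree ^ n) := by
  obtain ⟨C, hC, h⟩ := exists_upper P
  refine ⟨C, hC, fun n => ?_⟩
  induction n with
  | zero => intro w; simp
  | succ n ih =>
    intro w
    rw [Function.iterate_succ_apply', pow_succ, pow_mul]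
    have h1 := h ((fun z => P.eval z)^[n] w)
    set v := (fun z => P.eval z)^[n] w
    have hm : 1 ≤ max 1 ‖v‖ := le_max_left _ _
    calc C * max 1 ‖P.eval v‖ ≤ C * (C * max 1 ‖v‖ ^ P.natDegree) := by gcongr
      _ = C ^ 2 * max 1 ‖v‖ ^ P.natDegree := by ring
      _ ≤ C ^ P.natDegree * max 1 ‖v‖ ^ P.natDegree := by gcongr
      _ = (C * max 1 ‖v‖) ^ P.natDegree := by rw [mul_pow]
      _ ≤ _ := by
        have := ih w
        gcongr

/-- Escape-radius data for a polynomial. -/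
structure Esc (P : Polynomial ℂ) (κ R : ℝ) : Prop where
  pos : 0 < κ
  le_one : κ ≤ 1
  oneR : 1 ≤ R
  two : 2 ≤ κ * R
  low : ∀ w : ℂ, R ≤ ‖w‖ → κ * ‖w‖ ^ P.natDegree ≤ ‖P.eval w‖

theorem Esc.iter {P : Polynomial ℂ} {κ R : ℝ} (h : Esc P κ R) (hdeg : 2 ≤ P.natDegree) (n : ℕ)
    {w : ℂ} (hw : R ≤ ‖w‖) :
    R ≤ ‖(fun z => P.eval z)^[n] w‖ ∧
      (κ * ‖w‖) ^ (P.natDegree ^ n) ≤ κ * ‖(fun z => P.eval z)^[n] w‖ := by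
  induction n with
  | zero => simpa using hw
  | succ n ih =>
    obtain ⟨h1, h2⟩ := ih
    rw [Function.iterate_succ_apply', pow_succ, pow_mul]
    set v := (fun z => P.eval z)^[n] w
    have hl := h.low v h1
    have hk := h.pos
    have hv2 : 2 ≤ κ * ‖v‖ := h.two.trans (by gcongr)
    have hR := h.oneR
    have hv1 : 1 ≤ ‖v‖ := hR.trans h1
    constructor
    · have : ‖v‖ ^ 2 ≤ ‖v‖ ^ P.natDegree := pow_le_pow_right₀ hv1 hdeg
      have h5 : κ * ‖v‖ ^ 2 ≤ ‖P.eval v‖ := le_trans (by gcongr) hl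
      show R ≤ ‖P.eval v‖
      nlinarith
    · show _ ≤ κ * ‖P.eval v‖
      calc ((κ * ‖w‖) ^ P.natDegree ^ n) ^ P.natDegree ≤ (κ * ‖v‖) ^ P.natDegree := by gcongr
        _ = κ ^ P.natDegree * ‖v‖ ^ P.natDegree := mul_pow _ _ _
        _ ≤ κ ^ 2 * ‖v‖ ^ P.natDegree := by
          gcongr ?_ * _
          exact pow_le_pow_of_le_one hk.le h.le_one hdeg
        _ = κ * (κ * ‖v‖ ^ P.natDegree) := by ring
        _ ≤ _ := by gcongr

theorem Esc.two_pow {P : Polynomial ℂ} {κ R : ℝ} (h : Esc P κ R) (hdeg : 2 ≤ P.natDegree) (n : ℕ)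
    {w : ℂ} (hw : R ≤ ‖w‖) :
    (2 : ℝ) ^ (P.natDegree ^ n) ≤ ‖(fun z => P.eval z)^[n] w‖ := by
  have h1 := (h.iter hdeg n hw).2
  have hk := h.pos
  have : 2 ≤ κ * ‖w‖ := h.two.trans (by gcongr)
  calc (2 : ℝ) ^ (P.natDegree ^ n) ≤ (κ * ‖w‖) ^ (P.natDegree ^ n) := by gcongr
    _ ≤ _ := h1
    _ ≤ 1 * ‖(fun z => P.eval z)^[n] w‖ := by gcongr; exact h.le_one
    _ = _ := one_mul _

theorem tendsto_dpow {d : ℕ} (hd : 2 ≤ d) : Tendsto (fun n : ℕ => d ^ n) atTop atTop :=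
  tendsto_pow_atTop_atTop_of_one_lt (by omega)

theorem Esc.tendsto {P : Polynomial ℂ} {κ R : ℝ} (h : Esc P κ R) (hdeg : 2 ≤ P.natDegree)
    {z : ℂ} {n₀ : ℕ} (hw : R ≤ ‖(fun z => P.eval z)^[n₀] z‖) :
    Tendsto (fun n => ‖(fun z => P.eval z)^[n] z‖) atTop atTop := by
  rw [← tendsto_add_atTop_iff_nat n₀]
  have h2 : Tendsto (fun n : ℕ => (2 : ℝ) ^ (P.natDegree ^ n)) atTop atTop :=
    (tendsto_pow_atTop_atTop_of_one_lt (by norm_num : (1 : ℝ) < 2)).comp (tendsto_dpow hdeg)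
  refine tendsto_atTop_mono (fun n => ?_) h2
  have := h.two_pow hdeg n hw
  rwa [← Function.iterate_add_apply] at this

theorem mem_filledJulia {P : Polynomial ℂ} {κ R : ℝ} (h : Esc P κ R) (hdeg : 2 ≤ P.natDegree)
    (z : ℂ) : z ∈ filledJulia (fun z => P.eval z) ↔ ∀ n, ‖(fun z => P.eval z)^[n] z‖ < R := by
  constructor
  · intro hz n
    by_contra! hn
    have ht := h.tendsto hdeg hn
    obtain ⟨M, hM⟩ := isBounded_iff_forall_norm_le.1 (show Bornology.IsBounded (Set.range fun n : ℕ => (fun z => P.eval z)^[n] z) from hz)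
    obtain ⟨m, hm⟩ := (ht.eventually_gt_atTop M).exists
    exact absurd (hM _ ⟨m, rfl⟩) (not_le.2 hm)
  · intro hz
    show Bornology.IsBounded (Set.range fun n : ℕ => (fun z => P.eval z)^[n] z)
    refine isBounded_iff_forall_norm_le.2 ⟨R, ?_⟩
    rintro _ ⟨n, rfl⟩
    exact (hz n).le

theorem cont_iter (P : Polynomial ℂ) (n : ℕ) : Continuous (fun z => P.eval z)^[n] :=
  Continuous.iterate P.continuous n

theorem diff_iter (P : Polynomial ℂ) (n : ℕ) : Differentiable ℂ (fun z => P.eval z)^[n] :=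
  Differentiable.iterate P.differentiable n

theorem isClosed_filledJulia {P : Polynomial ℂ} {κ R : ℝ} (h : Esc P κ R)
    (hdeg : 2 ≤ P.natDegree) : IsClosed (filledJulia (fun z => P.eval z)) := by
  rw [← isOpen_compl_iff]
  have : (filledJulia (fun z => P.eval z))ᶜ = ⋃ n, {z | R < ‖(fun z => P.eval z)^[n] z‖} := by
    ext z
    simp only [mem_compl_iff, mem_filledJulia h hdeg, not_forall, not_lt, mem_iUnion, mem_ofPred_eq]
    constructor
    · rintro ⟨n, hn⟩
      obtain ⟨m, hm⟩ := ((h.tendsto hdeg hn).eventually_gt_atTop R).exists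
      exact ⟨m, hm⟩
    · rintro ⟨n, hn⟩
      exact ⟨n, hn.le⟩
  rw [this]
  exact isOpen_iUnion fun n => isOpen_lt continuous_const (cont_iter P n).norm

/-- Preperiodic points of a simple kind are in the filled Julia set. -/
theorem mem_filledJulia_of_fix {f : ℂ → ℂ} {w : ℂ} {n : ℕ} (h : f^[n + 1] w = f^[n] w) :
    w ∈ filledJulia f := by
  have key : ∀ k, f^[n + k] w = f^[n] w := by
    intro k
    induction k with
    | zero => rfl
    | succ k ih =>
      rw [← add_assoc, Function.iterate_succ_apply', ih, ← Function.iterate_succ_apply' f, h]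
  have : Set.range (fun k => f^[k] w) ⊆ (fun k => f^[k] w) '' (Set.Iic n) := by
    rintro _ ⟨k, rfl⟩
    rcases le_total k n with hk | hk
    · exact ⟨k, hk, rfl⟩
    · obtain ⟨j, rfl⟩ := Nat.exists_eq_add_of_le hk
      exact ⟨n, le_refl n, (key j).symm⟩
  exact (((Set.finite_Iic n).image _).subset this).isBounded

/-! ### Holomorphic roots and normal limits -/

theorem exists_root_on_ball {Q : ℂ → ℂ} {c : ℂ} {ρ : ℝ} (hQ : DifferentiableOn ℂ Q (ball c ρ))
    (h0 : ∀ z ∈ ball c ρ, Q z ≠ 0) {N : ℕ} (hN : N ≠ 0) :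
    ∃ F : ℂ → ℂ, DifferentiableOn ℂ F (ball c ρ) ∧ ∀ z ∈ ball c ρ, F z ^ N = Q z := by
  rcases le_or_gt ρ 0 with hρ | hρ
  · refine ⟨0, ?_, ?_⟩ <;> simp [ball_eq_empty.2 hρ]
  have hc : c ∈ ball c ρ := mem_ball_self hρ
  have hd : DifferentiableOn ℂ (fun z => deriv Q z / Q z) (ball c ρ) :=
    (hQ.deriv isOpen_ball).div hQ h0
  obtain ⟨g, hg0, hg⟩ := hd.isExactOn_ball.with_val_at c (Complex.log (Q c))
  have hQd : ∀ z ∈ ball c ρ, HasDerivAt Q (deriv Q z) z := fun z hz =>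
    (hQ.differentiableAt (isOpen_ball.mem_nhds hz)).hasDerivAt
  have hE : ∀ z ∈ ball c ρ, HasDerivAt (fun z => Complex.exp (- g z) * Q z) 0 z := by
    intro z hz
    have h1 := ((hg z hz).neg.cexp).mul (hQd z hz)
    have h2 : Complex.exp (-g z) * -(deriv Q z / Q z) * Q z + Complex.exp (-g z) * deriv Q z = 0 := by
      rw [mul_assoc, neg_mul, div_mul_cancel₀ _ (h0 z hz)]
      ring
    rw [← h2]
    exact h1
  have hconst : ∀ z ∈ ball c ρ, Complex.exp (- g z) * Q z = 1 := by
    intro z hz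
    have h1 : Complex.exp (- g c) * Q c = 1 := by
      rw [hg0, Complex.exp_neg, Complex.exp_log (h0 c hc), inv_mul_cancel₀ (h0 c hc)]
    rw [← h1]
    refine (convex_ball c ρ).is_const_of_fderivWithin_eq_zero (𝕜 := ℂ)
      (f := fun z => Complex.exp (- g z) * Q z) ?_ ?_ hz hc
    · exact fun x hx => (hE x hx).differentiableAt.differentiableWithinAt
    · intro x hx
      rw [fderivWithin_of_isOpen isOpen_ball hx]
      exact ((hE x hx).hasFDerivAt.fderiv).trans (by ext; simp)
  refine ⟨fun z => Complex.exp (g z / N), ?_, ?_⟩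
  · intro z hz
    exact (((hg z hz).div_const (N : ℂ)).cexp).differentiableAt.differentiableWithinAt
  · intro z hz
    have hN' : (N : ℂ) ≠ 0 := by exact_mod_cast hN
    rw [← Complex.exp_nat_mul, mul_div_cancel₀ _ hN']
    have := hconst z hz
    rw [Complex.exp_neg] at this
    have h3 := Complex.exp_ne_zero (g z)
    field_simp at this
    exact this.symm

theorem exists_normal_limit {F : ℕ → ℂ → ℂ} {c : ℂ} {ρ M : ℝ} (U : Ultrafilter ℕ)
    (hF : ∀ n, DifferentiableOn ℂ (F n) (ball c ρ))
    (hM : ∀ n, ∀ z ∈ ball c ρ, ‖F n z‖ ≤ M) :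
    ∃ A : ℂ → ℂ, DifferentiableOn ℂ A (ball c ρ) ∧
      ∀ z ∈ ball c ρ, Tendsto (fun n => F n z) U (nhds (A z)) := by
  have hlim : ∀ z, ∃ w, z ∈ ball c ρ → Tendsto (fun n => F n z) U (nhds w) := by
    intro z
    by_cases hz : z ∈ ball c ρ
    · have hK : IsCompact (closedBall (0 : ℂ) M) := isCompact_closedBall _ _
      obtain ⟨w, -, hw⟩ := hK.ultrafilter_le_nhds (U.map fun n => F n z) (by
        rw [Filter.le_principal_iff]
        show ∀ᶠ n in (U : Filter ℕ), F n z ∈ closedBall (0 : ℂ) M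
        refine Filter.Eventually.of_forall fun n => ?_
        simpa using hM n z hz)
      exact ⟨w, fun _ => hw⟩
    · exact ⟨0, fun h => absurd h hz⟩
  choose A hA using hlim
  refine ⟨A, ?_, hA⟩
  have hequi : ∀ z ∈ ball c ρ, EquicontinuousAt F z := by
    intro z hz
    obtain ⟨r, hr, hsub⟩ := Metric.isOpen_iff.1 isOpen_ball z hz
    have hM0 : 0 ≤ M := (norm_nonneg _).trans (hM 0 z hz)
    refine Metric.equicontinuousAt_of_continuity_modulus (fun x => 2 * M / r * dist z x) ?_ F ?_
    · have : Continuous fun x => 2 * M / r * dist z x := by fun_prop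
      simpa using this.tendsto z
    · filter_upwards [ball_mem_nhds z hr] with x hx n
      rw [dist_comm, dist_comm z x]
      refine Complex.dist_le_div_mul_dist_of_mapsTo_ball ((hF n).mono hsub) ?_ hx
      intro y hy
      rw [mem_closedBall, dist_eq_norm]
      have h1 := hM n y (hsub hy)
      have h2 := hM n z hz
      exact (norm_sub_le _ _).trans (by linarith)
  have huni : ∀ K ⊆ ball c ρ, IsCompact K → TendstoUniformlyOn F A U K := by
    intro K hKs hK
    have := (EquicontinuousOn.tendsto_uniformOnFun_iff_pi' (𝔖 := {K}) (F := F)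
      (by simpa using hK) (by
        intro K' hK'
        rw [mem_singleton_iff] at hK'
        subst hK'
        exact fun x hx => (hequi x (hKs hx)).equicontinuousWithinAt _) U A).2 (by
        rw [tendsto_pi_nhds]
        rintro ⟨x, hx⟩
        simp only [sUnion_singleton] at hx
        exact hA x (hKs hx))
    rw [UniformOnFun.tendsto_iff_tendstoUniformlyOn] at this
    exact this K rfl
  have hloc : TendstoLocallyUniformlyOn F A U (ball c ρ) :=
    (tendstoLocallyUniformlyOn_iff_forall_isCompact isOpen_ball).2 huni
  exact hloc.differentiableOn (Eventually.of_forall hF) isOpen_ball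

theorem tendsto_of_pow_mem {U : Filter ℕ} {x : ℕ → ℝ} {N : ℕ → ℕ} {lo hi : ℝ} (hlo : 0 < lo)
    (hx : ∀ n, 0 ≤ x n) (hN : Tendsto N U atTop)
    (h : ∀ᶠ n in U, lo ≤ x n ^ N n ∧ x n ^ N n ≤ hi) : Tendsto x U (nhds 1) := by
  have hrpow : ∀ a : ℝ, 0 < a → Tendsto (fun n => a ^ ((N n : ℝ)⁻¹)) U (nhds 1) := by
    intro a ha
    have h1 : Tendsto (fun n => ((N n : ℝ)⁻¹)) U (nhds 0) :=
      tendsto_inv_atTop_zero.comp (tendsto_natCast_atTop_atTop.comp hN)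
    have h2 := (Real.continuous_const_rpow ha.ne').tendsto 0
    rw [Real.rpow_zero] at h2
    exact h2.comp h1
  rcases Filter.eq_or_neBot U with rfl | hU
  · simp
  have hhi : 0 < hi := by
    obtain ⟨n, h1, h2⟩ := h.exists
    linarith
  have key : ∀ᶠ n in U, x n = (x n ^ N n) ^ ((N n : ℝ)⁻¹) := by
    filter_upwards [hN.eventually_gt_atTop 0] with n hn
    rw [Real.pow_rpow_inv_natCast (hx n) hn.ne']
  refine tendsto_of_tendsto_of_tendsto_of_le_of_le' (hrpow lo hlo) (hrpow hi hhi) ?_ ?_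
  · filter_upwards [key, h] with n h1 h2
    rw [h1]
    exact Real.rpow_le_rpow hlo.le h2.1 (by positivity)
  · filter_upwards [key, h] with n h1 h2
    rw [h1]
    exact Real.rpow_le_rpow (pow_nonneg (hx n) _) h2.2 (by positivity)

/-! ### The omitted-values argument -/

/-- The iterate-roots of `f^[n] - a` and a normal limit of them. -/
structure RootLim (P : Polynomial ℂ) (U : Ultrafilter ℕ) (c : ℂ) (ρ : ℝ) (a : ℂ)
    (F : ℕ → ℂ → ℂ) (A : ℂ → ℂ) : Prop where
  diff : DifferentiableOn ℂ A (ball c ρ)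
  lim : ∀ z ∈ ball c ρ, Tendsto (fun n => F n z) U (nhds (A z))
  root : ∀ n, ∀ z ∈ ball c ρ, F n z ^ (P.natDegree ^ n) = (fun z => P.eval z)^[n] z - a
  ne : ∀ n, ∀ z ∈ ball c ρ, F n z ≠ 0

theorem exists_rootLim (P : Polynomial ℂ) (hdeg : 2 ≤ P.natDegree) (U : Ultrafilter ℕ)
    (c : ℂ) (ρ : ℝ) (a : ℂ) (ha : ∀ z ∈ ball c ρ, ∀ n, (fun z => P.eval z)^[n] z ≠ a) :
    ∃ F A, RootLim P U c ρ a F A := by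
  have hN : ∀ n, P.natDegree ^ n ≠ 0 := fun n => pow_ne_zero _ (by omega)
  have h1 : ∀ n, ∃ F : ℂ → ℂ, DifferentiableOn ℂ F (ball c ρ) ∧
      ∀ z ∈ ball c ρ, F z ^ (P.natDegree ^ n) = (fun z => P.eval z)^[n] z - a := fun n =>
    exists_root_on_ball (((diff_iter P n).sub_const a).differentiableOn)
      (fun z hz => sub_ne_zero.2 (ha z hz n)) (hN n)
  choose F hF hroot using h1
  obtain ⟨C, hC, hup⟩ := iter_upper P hdeg
  have hbound : ∀ n, ∀ z ∈ ball c ρ, ‖F n z‖ ≤ (1 + ‖a‖) * (C * (1 + (‖c‖ + ρ))) := by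
    intro n z hz
    have hz' : ‖z‖ ≤ ‖c‖ + ρ := by
      have := norm_le_norm_add_norm_sub' z c
      rw [mem_ball, dist_eq_norm] at hz
      linarith
    have hcr : 0 ≤ ‖c‖ + ρ := (norm_nonneg z).trans hz'
    have hmax : max 1 ‖z‖ ≤ 1 + (‖c‖ + ρ) := max_le (by linarith) (by linarith)
    refine le_of_pow_le_pow_left₀ (hN n) (by positivity) ?_
    rw [← norm_pow, hroot n z hz, mul_pow]
    have h2 := hup n z
    set v := (fun z => P.eval z)^[n] z
    have h3 : max 1 ‖v‖ ≤ C * max 1 ‖v‖ := le_mul_of_one_le_left (by positivity) hC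
    have h4 : (C * max 1 ‖z‖) ^ P.natDegree ^ n ≤ (C * (1 + (‖c‖ + ρ))) ^ P.natDegree ^ n := by
      gcongr
    have h5 : 1 + ‖a‖ ≤ (1 + ‖a‖) ^ P.natDegree ^ n :=
      le_self_pow₀ (by linarith [norm_nonneg a]) (hN n)
    have h6 : ‖v‖ ≤ max 1 ‖v‖ := le_max_right _ _
    have h7 : 1 ≤ max 1 ‖v‖ := le_max_left _ _
    calc ‖v - a‖ ≤ ‖v‖ + ‖a‖ := norm_sub_le _ _
      _ ≤ (1 + ‖a‖) * max 1 ‖v‖ := by nlinarith [norm_nonneg a]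
      _ ≤ _ := by
        refine mul_le_mul h5 (h3.trans (h2.trans h4)) (by positivity) (by positivity)
  obtain ⟨A, hA, hlim⟩ := exists_normal_limit U hF hbound
  refine ⟨F, A, hA, hlim, hroot, fun n z hz h0 => ?_⟩
  have := hroot n z hz
  rw [h0, zero_pow (hN n)] at this
  exact sub_ne_zero.2 (ha z hz n) this.symm

section
variable {P : Polynomial ℂ} {κ R : ℝ} {U : Ultrafilter ℕ} {c : ℂ} {ρ : ℝ} {a b : ℂ}
  {F G : ℕ → ℂ → ℂ} {A B : ℂ → ℂ}

theorem RootLim.norm_eq_one (h : Esc P κ R) (hdeg : 2 ≤ P.natDegree) (hU : (U : Filter ℕ) ≤ atTop)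
    (hA : RootLim P U c ρ a F A) {z : ℂ} (hz : z ∈ ball c ρ)
    (hK : z ∈ filledJulia (fun z => P.eval z)) {δ : ℝ} (hδ : 0 < δ)
    (hd : ∀ᶠ n in (U : Filter ℕ), δ ≤ ‖(fun z => P.eval z)^[n] z - a‖) : ‖A z‖ = 1 := by
  have h1 := (hA.lim z hz).norm
  refine tendsto_nhds_unique h1 (tendsto_of_pow_mem (lo := δ) (hi := R + ‖a‖) hδ
    (fun n => norm_nonneg _) ((tendsto_dpow hdeg).mono_left hU) ?_)
  filter_upwards [hd] with n hn
  rw [← norm_pow, hA.root n z hz]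
  refine ⟨hn, (norm_sub_le _ _).trans ?_⟩
  have := (mem_filledJulia h hdeg z).1 hK n
  linarith

theorem RootLim.one_lt (h : Esc P κ R) (hdeg : 2 ≤ P.natDegree) (hU : (U : Filter ℕ) ≤ atTop)
    (hA : RootLim P U c ρ a F A) {z : ℂ} (hz : z ∈ ball c ρ)
    (hK : z ∉ filledJulia (fun z => P.eval z)) : 1 < ‖A z‖ := by
  rw [mem_filledJulia h hdeg] at hK
  push Not at hK
  obtain ⟨n₀, hn₀⟩ := hK
  have hev : ∀ᶠ n in atTop, 3 / 2 ≤ ‖F n z‖ ^ (P.natDegree ^ n₀) := by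
    have h43 : Tendsto (fun n : ℕ => (4 / 3 : ℝ) ^ (P.natDegree ^ n)) atTop atTop :=
      (tendsto_pow_atTop_atTop_of_one_lt (by norm_num : (1 : ℝ) < 4 / 3)).comp (tendsto_dpow hdeg)
    rw [← Filter.map_add_atTop_eq_nat n₀, Filter.eventually_map]
    filter_upwards [h43.eventually_ge_atTop (1 + ‖a‖)] with m hm
    have hN : P.natDegree ^ m ≠ 0 := pow_ne_zero _ (by omega)
    refine le_of_pow_le_pow_left₀ hN (by positivity) ?_
    rw [← pow_mul, ← norm_pow, ← pow_add, add_comm n₀ m, hA.root _ z hz]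
    have h2 := h.two_pow hdeg m hn₀
    rw [← Function.iterate_add_apply] at h2
    have h3 : (1 : ℝ) ≤ (3 / 2 : ℝ) ^ (P.natDegree ^ m) := one_le_pow₀ (by norm_num)
    have h4 : (2 : ℝ) ^ (P.natDegree ^ m) =
        (3 / 2 : ℝ) ^ (P.natDegree ^ m) * (4 / 3 : ℝ) ^ (P.natDegree ^ m) := by
      rw [← mul_pow]; norm_num
    have h5 := norm_sub_norm_le ((fun z => P.eval z)^[m + n₀] z) a
    nlinarith [norm_nonneg a]
  have h6 := ge_of_tendsto ((hA.lim z hz).norm.pow (P.natDegree ^ n₀)) (hU hev)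
  by_contra! hle
  have := pow_le_one₀ (n := P.natDegree ^ n₀) (norm_nonneg _) hle
  linarith

theorem RootLim.norm_eq (h : Esc P κ R) (hdeg : 2 ≤ P.natDegree) (hU : (U : Filter ℕ) ≤ atTop)
    (hA : RootLim P U c ρ a F A) (hB : RootLim P U c ρ b G B) {z : ℂ} (hz : z ∈ ball c ρ)
    (hK : z ∉ filledJulia (fun z => P.eval z)) : ‖A z‖ = ‖B z‖ := by
  rw [mem_filledJulia h hdeg] at hK
  push Not at hK
  obtain ⟨n₀, hn₀⟩ := hK
  have hinf := h.tendsto hdeg hn₀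
  have hx : Tendsto (fun n => ‖F n z‖ / ‖G n z‖) U (nhds 1) := by
    refine tendsto_of_pow_mem (lo := 1 / 2) (hi := 2) (by norm_num)
      (fun n => by positivity) ((tendsto_dpow hdeg).mono_left hU) (hU ?_)
    filter_upwards [hinf.eventually_ge_atTop (1 + 2 * ‖a‖ + 2 * ‖b‖)] with n hn
    rw [div_pow, ← norm_pow, ← norm_pow, hA.root n z hz, hB.root n z hz]
    set v := (fun z => P.eval z)^[n] z
    have h1 := norm_sub_norm_le v a
    have h2 := norm_sub_norm_le v b
    have h3 := norm_sub_le v a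
    have h4 := norm_sub_le v b
    have h5 := norm_nonneg a
    have h6 := norm_nonneg b
    have h7 : 0 < ‖v - b‖ := by linarith
    rw [le_div_iff₀ h7, div_le_iff₀ h7]
    constructor <;> linarith
  have h8 : Tendsto (fun n => ‖F n z‖ / ‖G n z‖ * ‖G n z‖) U (nhds (1 * ‖B z‖)) :=
    hx.mul (hB.lim z hz).norm
  rw [one_mul] at h8
  refine tendsto_nhds_unique (hA.lim z hz).norm (h8.congr fun n => ?_)
  rw [div_mul_cancel₀]
  exact norm_ne_zero_iff.2 (hB.ne n z hz)

end

theorem exists_preimage (P : Polynomial ℂ) (hdeg : 2 ≤ P.natDegree) {κ R : ℝ} (h : Esc P κ R)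
    {c : ℂ} (hc : c ∈ juliaSet (fun z => P.eval z)) {ρ : ℝ} (hρ : 0 < ρ) {a b : ℂ} (hab : a ≠ b) :
    ∃ z ∈ ball c ρ, ∃ n, (fun z => P.eval z)^[n] z = a ∨ (fun z => P.eval z)^[n] z = b := by
  by_contra! hcon
  have hU : ((Filter.hyperfilter ℕ : Ultrafilter ℕ) : Filter ℕ) ≤ atTop :=
    Nat.hyperfilter_le_atTop
  set U := Filter.hyperfilter ℕ
  obtain ⟨F, A, hA⟩ := exists_rootLim P hdeg U c ρ a fun z hz n => (hcon z hz n).1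
  obtain ⟨G, B, hB⟩ := exists_rootLim P hdeg U c ρ b fun z hz n => (hcon z hz n).2
  set K := filledJulia (fun z => P.eval z) with hKdef
  have hKc : IsClosed K := isClosed_filledJulia h hdeg
  have hcb : c ∈ ball c ρ := mem_ball_self hρ
  -- points off `K` near `c`
  have hnear : ∀ s ∈ nhds c, ∃ z ∈ s, z ∉ K := by
    intro s hs
    have h1 : c ∈ closure Kᶜ := by
      have : c ∈ frontier K := hc
      rw [frontier_eq_closure_inter_closure] at this
      exact this.2
    obtain ⟨z, hz, hzK⟩ := mem_closure_iff_nhds.1 h1 s hs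
    exact ⟨z, hz, hzK⟩
  have hcK : c ∈ K := hKc.frontier_subset hc
  -- `A = t B` on the ball with `‖t‖ = 1`
  obtain ⟨z₀, hz₀, hz₀K⟩ := hnear _ (isOpen_ball.mem_nhds hcb)
  have hV : ball c ρ ∩ Kᶜ ∈ nhds z₀ := (isOpen_ball.inter hKc.isOpen_compl).mem_nhds ⟨hz₀, hz₀K⟩
  have hBne : ∀ z ∈ ball c ρ ∩ Kᶜ, B z ≠ 0 := fun z hz => by
    have := hB.one_lt h hdeg hU hz.1 hz.2
    intro h0
    rw [h0, norm_zero] at this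
    linarith
  have hq1 : ∀ z ∈ ball c ρ ∩ Kᶜ, ‖A z / B z‖ = 1 := fun z hz => by
    rw [norm_div, hA.norm_eq h hdeg hU hB hz.1 hz.2, div_self]
    exact norm_ne_zero_iff.2 (hBne z hz)
  have hdiffA : ∀ z ∈ ball c ρ, DifferentiableAt ℂ A z := fun z hz =>
    hA.diff.differentiableAt (isOpen_ball.mem_nhds hz)
  have hdiffB : ∀ z ∈ ball c ρ, DifferentiableAt ℂ B z := fun z hz =>
    hB.diff.differentiableAt (isOpen_ball.mem_nhds hz)
  have hloc := Complex.eventually_eq_of_isLocalMax_norm (f := fun z => A z / B z) (c := z₀)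
    (by filter_upwards [hV] with z hz using (hdiffA z hz.1).div (hdiffB z hz.1) (hBne z hz))
    (by
      show ∀ᶠ z in nhds z₀, ‖A z / B z‖ ≤ ‖A z₀ / B z₀‖
      filter_upwards [hV] with z hz
      rw [hq1 z hz, hq1 z₀ ⟨hz₀, hz₀K⟩])
  set t := A z₀ / B z₀ with ht
  have htn : ‖t‖ = 1 := hq1 z₀ ⟨hz₀, hz₀K⟩
  have heq : EqOn A (fun z => t * B z) (ball c ρ) := by
    refine AnalyticOnNhd.eqOn_of_preconnected_of_eventuallyEq (hA.diff.analyticOnNhd isOpen_ball)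
      ((hB.diff.const_mul t).analyticOnNhd isOpen_ball) (convex_ball c ρ).isPreconnected hz₀ ?_
    filter_upwards [hV, hloc] with z hz hzt
    have := hBne z hz
    rw [← hzt, div_mul_cancel₀ _ this]
  have hnorm : ∀ z ∈ ball c ρ, ‖A z‖ = ‖B z‖ := fun z hz => by
    rw [heq hz]; simp [htn]
  -- on `K`, the norm is one
  have hone : ∀ z ∈ ball c ρ, z ∈ K → ‖A z‖ = 1 := by
    intro z hz hzK
    have hδ : 0 < ‖a - b‖ / 2 := by
      have := norm_pos_iff.2 (sub_ne_zero.2 hab)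
      linarith
    have hor : ∀ᶠ n in (U : Filter ℕ), ‖a - b‖ / 2 ≤ ‖(fun z => P.eval z)^[n] z - a‖ ∨
        ‖a - b‖ / 2 ≤ ‖(fun z => P.eval z)^[n] z - b‖ := by
      refine Eventually.of_forall fun n => ?_
      by_contra! hlt
      have h1 := norm_sub_le_norm_sub_add_norm_sub a ((fun z => P.eval z)^[n] z) b
      rw [norm_sub_rev a ((fun z => P.eval z)^[n] z)] at h1
      linarith [hlt.1, hlt.2]
    rcases Ultrafilter.eventually_or.1 hor with h1 | h1
    · exact hA.norm_eq_one h hdeg hU hz hzK hδ h1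
    · rw [hnorm z hz]
      exact hB.norm_eq_one h hdeg hU hz hzK hδ h1
  have hge : ∀ z ∈ ball c ρ, 1 ≤ ‖A z‖ := by
    intro z hz
    by_cases hzK : z ∈ K
    · exact (hone z hz hzK).ge
    · exact (hA.one_lt h hdeg hU hz hzK).le
  have hAne : ∀ z ∈ ball c ρ, A z ≠ 0 := fun z hz h0 => by
    have := hge z hz
    rw [h0, norm_zero] at this
    linarith
  have hloc2 := Complex.eventually_eq_of_isLocalMax_norm (f := fun z => (A z)⁻¹) (c := c)
    (by filter_upwards [isOpen_ball.mem_nhds hcb] with z hz using (hdiffA z hz).inv (hAne z hz))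
    (by
      show ∀ᶠ z in nhds c, ‖(A z)⁻¹‖ ≤ ‖(A c)⁻¹‖
      filter_upwards [isOpen_ball.mem_nhds hcb] with z hz
      rw [norm_inv, norm_inv, hone c hcb hcK, inv_one]
      exact inv_le_one_of_one_le₀ (hge z hz))
  obtain ⟨z, ⟨hzb, hze⟩, hzK⟩ := hnear _ (inter_mem (isOpen_ball.mem_nhds hcb) hloc2)
  have h1 := hA.one_lt h hdeg hU hzb hzK
  have h2 : A z = A c := inv_injective hze
  rw [h2, hone c hcb hcK] at h1
  exact lt_irrefl _ h1

/-! ### Preperiodic points and root certificates -/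

theorem exists_two_fix (P : Polynomial ℂ) (hdeg : 2 ≤ P.natDegree) :
    ∃ a b : ℂ, a ≠ b ∧ P.eval (P.eval a) = P.eval a ∧ P.eval (P.eval b) = P.eval b := by
  have hPX : (P - X).natDegree = P.natDegree :=
    natDegree_sub_eq_left_of_natDegree_lt (by rw [natDegree_X]; omega)
  obtain ⟨a, ha⟩ := IsAlgClosed.exists_root (P - X) (by
    intro h0
    have : (P - X).natDegree = 0 := natDegree_eq_of_degree_eq_some (by simpa using h0)
    omega)
  have hfa : P.eval a = a := by
    simpa [IsRoot, sub_eq_zero] using ha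
  by_cases hb : ∃ b, b ≠ a ∧ P.eval b = a
  · obtain ⟨b, hba, hb⟩ := hb
    exact ⟨a, b, hba.symm, by rw [hfa, hfa], by rw [hb, hfa]⟩
  · push Not at hb
    have hQdeg : (P - C a).natDegree = P.natDegree := natDegree_sub_C
    have hsp : (P - C a).Splits := IsAlgClosed.splits _
    have hroots : (P - C a).roots = Multiset.replicate P.natDegree a := by
      rw [Multiset.eq_replicate]
      refine ⟨by rw [← hsp.natDegree_eq_card_roots, hQdeg], fun b hb' => ?_⟩
      have h1 := isRoot_of_mem_roots hb'
      have h2 : P.eval b = a := by simpa [IsRoot, sub_eq_zero] using h1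
      by_contra hne
      exact hb b hne h2
    have hev : ∀ z, P.eval z - a = (P - C a).leadingCoeff * (z - a) ^ P.natDegree := by
      intro z
      have := hsp.eval_eq_prod_roots z
      rw [hroots] at this
      simpa using this
    set L := (P - C a).leadingCoeff with hL
    have hL0 : L ≠ 0 := by
      rw [hL, leadingCoeff_ne_zero]
      intro h0
      rw [h0, natDegree_zero] at hQdeg
      omega
    obtain ⟨t, ht⟩ := IsAlgClosed.exists_pow_nat_eq L⁻¹ (n := P.natDegree - 1) (by omega)
    have ht0 : t ≠ 0 := by
      rintro rfl
      rw [zero_pow (by omega)] at ht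
      exact inv_ne_zero hL0 ht.symm
    have hfb : P.eval (a + t) = a + t := by
      have h1 := hev (a + t)
      rw [add_sub_cancel_left, show P.natDegree = (P.natDegree - 1) + 1 by omega, pow_succ, ht,
        ← mul_assoc, mul_inv_cancel₀ hL0, one_mul] at h1
      linear_combination h1
    exact ⟨a, a + t, by simpa using ht0, by rw [hfa, hfa], by rw [hfb, hfb]⟩

theorem exists_near_root (Q : Polynomial ℂ) {c : ℂ} {s : ℝ} (hs : 0 < s)
    (h : ‖Q.eval c‖ < ‖Q.leadingCoeff‖ * s ^ Q.natDegree) :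
    ∃ w, Q.eval w = 0 ∧ ‖w - c‖ < s := by
  have hsp : Q.Splits := IsAlgClosed.splits _
  by_contra! hcon
  have hev := hsp.eval_eq_prod_roots c
  have hprod : s ^ Q.natDegree ≤ ‖(Q.roots.map (fun r => c - r)).prod‖ := by
    rw [hsp.natDegree_eq_card_roots]
    have : ∀ m : Multiset ℂ, (∀ r ∈ m, s ≤ ‖c - r‖) →
        s ^ m.card ≤ ‖(m.map (fun r => c - r)).prod‖ := by
      intro m
      induction m using Multiset.induction_on with
      | empty => simp
      | cons r m ih =>
        intro hm
        rw [Multiset.map_cons, Multiset.prod_cons, norm_mul, Multiset.card_cons, pow_succ']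
        exact mul_le_mul (hm r (Multiset.mem_cons_self _ _))
          (ih fun x hx => hm x (Multiset.mem_cons_of_mem hx)) (by positivity) (norm_nonneg _)
    refine this _ fun r hr => ?_
    have h1 := hcon r (isRoot_of_mem_roots hr)
    rwa [norm_sub_rev] at h1
  rw [hev, norm_mul] at h
  have := mul_le_mul_of_nonneg_left hprod (norm_nonneg Q.leadingCoeff)
  linarith

theorem iterPoly_lead (P : Polynomial ℂ) (hdeg : 2 ≤ P.natDegree) {l : ℝ} (hl : 0 < l)
    (hl1 : l ≤ 1) (hlP : l ≤ ‖P.leadingCoeff‖) (n : ℕ) :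
    ∃ Q : Polynomial ℂ, Q.natDegree = P.natDegree ^ n ∧ l ^ (P.natDegree ^ n) ≤ ‖Q.leadingCoeff‖ * l ∧
      ∀ z, Q.eval z = (fun z => P.eval z)^[n] z := by
  induction n with
  | zero => exact ⟨X, by simp, by simp, by simp⟩
  | succ n ih =>
    obtain ⟨Q, hQ, hQl, hQe⟩ := ih
    refine ⟨P.comp Q, ?_, ?_, ?_⟩
    · rw [natDegree_comp, hQ, pow_succ']
    · have hne : Q.natDegree ≠ 0 := by rw [hQ]; exact pow_ne_zero _ (by omega)
      rw [leadingCoeff_comp hne, norm_mul, norm_pow, pow_succ, pow_mul]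
      calc (l ^ P.natDegree ^ n) ^ P.natDegree ≤ (‖Q.leadingCoeff‖ * l) ^ P.natDegree := by gcongr
        _ = ‖Q.leadingCoeff‖ ^ P.natDegree * l ^ P.natDegree := mul_pow _ _ _
        _ ≤ ‖Q.leadingCoeff‖ ^ P.natDegree * l ^ 2 :=
          mul_le_mul_of_nonneg_left (pow_le_pow_of_le_one hl.le hl1 hdeg) (by positivity)
        _ = l * ‖Q.leadingCoeff‖ ^ P.natDegree * l := by ring
        _ ≤ ‖P.leadingCoeff‖ * ‖Q.leadingCoeff‖ ^ P.natDegree * l := by gcongr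
    · intro z
      rw [eval_comp, hQe, Function.iterate_succ_apply']

theorem exists_near_fix (P : Polynomial ℂ) (hdeg : 2 ≤ P.natDegree) {l : ℝ} (hl : 0 < l)
    (hl1 : l ≤ 1) (hlP : l ≤ ‖P.leadingCoeff‖) (n : ℕ) {c : ℂ} {s : ℝ} (hs : 0 < s)
    (h : ‖(fun z => P.eval z)^[n + 1] c - (fun z => P.eval z)^[n] c‖
      < (l * s) ^ (P.natDegree ^ (n + 1))) :
    ∃ w, (fun z => P.eval z)^[n + 1] w = (fun z => P.eval z)^[n] w ∧ ‖w - c‖ < s := by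
  obtain ⟨Q, hQ, hQl, hQe⟩ := iterPoly_lead P hdeg hl hl1 hlP n
  obtain ⟨Q', hQ', hQl', hQe'⟩ := iterPoly_lead P hdeg hl hl1 hlP (n + 1)
  have hlt : Q.natDegree < Q'.natDegree := by
    rw [hQ, hQ']; exact Nat.pow_lt_pow_right (by omega) (by omega)
  have hd : (Q' - Q).natDegree = P.natDegree ^ (n + 1) := by
    rw [natDegree_sub_eq_left_of_natDegree_lt hlt, hQ']
  have hlc : (Q' - Q).leadingCoeff = Q'.leadingCoeff :=
    leadingCoeff_sub_of_degree_lt (degree_lt_degree hlt)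
  obtain ⟨w, hw, hwc⟩ := exists_near_root (Q' - Q) (c := c) hs (by
    rw [hd, hlc, eval_sub, hQe, hQe']
    refine h.trans_le ?_
    rw [mul_pow]
    refine mul_le_mul_of_nonneg_right (hQl'.trans ?_) (by positivity)
    exact mul_le_of_le_one_right (norm_nonneg _) hl1)
  refine ⟨w, ?_, hwc⟩
  rw [eval_sub, hQe, hQe', sub_eq_zero] at hw
  exact hw

theorem meets_of {K : Set ℂ} (hK : IsClosed K) {c : ℂ} {r : ℝ} {w e : ℂ}
    (hw : w ∈ ball c r) (hwK : w ∈ K) (he : e ∈ ball c r) (heK : e ∉ K) :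
    (ball c r ∩ frontier K).Nonempty := by
  by_contra hcon
  rw [not_nonempty_iff_eq_empty] at hcon
  have hfr : ∀ z ∈ ball c r, z ∉ frontier K := fun z hz hf => by
    have : z ∈ ball c r ∩ frontier K := ⟨hz, hf⟩
    rw [hcon] at this
    exact this
  have hinter : ∀ z ∈ ball c r, z ∈ K → z ∈ interior K := by
    intro z hz hzK
    by_contra hzi
    exact hfr z hz ⟨subset_closure hzK, hzi⟩
  obtain ⟨z, -, hz1, hz2⟩ := (convex_ball c r).isPreconnected (interior K) Kᶜ isOpen_interior
    hK.isOpen_compl (fun z hz => by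
      by_cases hzK : z ∈ K
      · exact Or.inl (hinter z hz hzK)
      · exact Or.inr hzK) ⟨w, hw, hinter w hw hwK⟩ ⟨e, he, heK⟩
  exact hz2 (interior_subset hz1)

theorem of_meets (P : Polynomial ℂ) (hdeg : 2 ≤ P.natDegree) {κ R : ℝ} (h : Esc P κ R)
    {c : ℂ} {r : ℝ} (hm : (ball c r ∩ juliaSet (fun z => P.eval z)).Nonempty) :
    (∃ w ∈ ball c r, ∃ n, (fun z => P.eval z)^[n + 1] w = (fun z => P.eval z)^[n] w) ∧
      ∃ e ∈ ball c r, e ∉ filledJulia (fun z => P.eval z) := by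
  obtain ⟨z, hz, hzJ⟩ := hm
  constructor
  · obtain ⟨ρ, hρ, hsub⟩ := Metric.isOpen_iff.1 isOpen_ball z hz
    obtain ⟨a, b, hab, ha, hb⟩ := exists_two_fix P hdeg
    obtain ⟨w, hw, n, hn⟩ := exists_preimage P hdeg h hzJ hρ hab
    refine ⟨w, hsub hw, n + 1, ?_⟩
    rw [Function.iterate_succ_apply', Function.iterate_succ_apply']
    rcases hn with hn | hn <;> rw [hn] <;> assumption
  · have h1 : z ∈ closure (filledJulia (fun z => P.eval z))ᶜ := by
      have : z ∈ frontier (filledJulia (fun z => P.eval z)) := hzJ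
      rw [frontier_eq_closure_inter_closure] at this
      exact this.2
    obtain ⟨e, he, heK⟩ := mem_closure_iff_nhds.1 h1 _ (isOpen_ball.mem_nhds hz)
    exact ⟨e, he, heK⟩

theorem juliaSet_nonempty (P : Polynomial ℂ) (hdeg : 2 ≤ P.natDegree) {κ R : ℝ} (h : Esc P κ R) :
    (juliaSet (fun z => P.eval z)).Nonempty := by
  refine nonempty_frontier_iff.2 ⟨?_, ?_⟩
  · obtain ⟨a, b, hab, ha, hb⟩ := exists_two_fix P hdeg
    exact ⟨a, mem_filledJulia_of_fix (n := 1) (by simpa using ha)⟩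
  · intro hu
    have : (R : ℂ) ∈ filledJulia (fun z => P.eval z) := by rw [hu]; trivial
    have h1 := (mem_filledJulia h hdeg _).1 this 0
    have h2 := h.oneR
    simp [abs_of_nonneg (zero_le_one.trans h2)] at h1

/-! ### Computable assembly -/

/-- Squared euclidean distance of rational points. -/
def sqd (c c' : ℚ × ℚ) : ℚ := (c.1 - c'.1) * (c.1 - c'.1) + (c.2 - c'.2) * (c.2 - c'.2)

theorem comp_sqd {α : Type*} [Primcodable α] {f g : α → ℚ × ℚ} (hf : Computable f)
    (hg : Computable g) : Computable fun a => sqd (f a) (g a) := by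
  have f1 : Computable fun a => (f a).1 := Computable.fst.comp hf
  have f2 : Computable fun a => (f a).2 := Computable.snd.comp hf
  have g1 : Computable fun a => (g a).1 := Computable.fst.comp hg
  have g2 : Computable fun a => (g a).2 := Computable.snd.comp hg
  exact (qadd (qmul (qsub f1 g1) (qsub f1 g1)) (qmul (qsub f2 g2) (qsub f2 g2))).of_eq fun a => rfl

theorem sqd_eq (c c' : ℚ × ℚ) : (sqd c c' : ℝ) = dist (ratPoint c) (ratPoint c') ^ 2 := by
  rw [dist_eq_norm, Complex.sq_norm, Complex.normSq_apply]
  simp [ratPoint, sqd]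

theorem sqd_le {c c' : ℚ × ℚ} {t : ℚ} (ht : 0 ≤ t) :
    sqd c c' ≤ t * t ↔ dist (ratPoint c) (ratPoint c') ≤ t := by
  have h : (sqd c c' ≤ t * t) ↔ ((sqd c c' : ℝ) ≤ (t : ℝ) ^ 2) := by
    rw [sq]; exact_mod_cast Iff.rfl
  rw [h, sqd_eq, sq_le_sq₀ dist_nonneg (by exact_mod_cast ht)]

theorem sqd_lt {c c' : ℚ × ℚ} {t : ℚ} (ht : 0 ≤ t) :
    sqd c c' < t * t ↔ dist (ratPoint c) (ratPoint c') < t := by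
  have h : (sqd c c' < t * t) ↔ ((sqd c c' : ℝ) < (t : ℝ) ^ 2) := by
    rw [sq]; exact_mod_cast Iff.rfl
  rw [h, sqd_eq, sq_lt_sq₀ dist_nonneg (by exact_mod_cast ht)]

theorem lt_sqd {c c' : ℚ × ℚ} {t : ℚ} (ht : 0 ≤ t) :
    t * t < sqd c c' ↔ (t : ℝ) < dist (ratPoint c) (ratPoint c') := by
  rw [← not_le, sqd_le ht, not_le]

theorem exists_ratPoint_near (z : ℂ) {ε : ℝ} (hε : 0 < ε) : ∃ q : ℚ × ℚ, dist (ratPoint q) z < ε := by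
  obtain ⟨x, hx1, hx2⟩ := exists_rat_btwn (show z.re < z.re + ε / 2 by linarith)
  obtain ⟨y, hy1, hy2⟩ := exists_rat_btwn (show z.im < z.im + ε / 2 by linarith)
  refine ⟨(x, y), ?_⟩
  rw [dist_eq_norm]
  refine (Complex.norm_le_abs_re_add_abs_im _).trans_lt ?_
  simp only [ratPoint, Complex.sub_re, Complex.sub_im]
  rw [abs_of_pos (by linarith), abs_of_pos (by linarith)]
  linarith

theorem enum_of_test {T β : Type*} [Primcodable T] [Primcodable β] {τ : T → Bool}
    (hτ : Computable τ) {b : T → β} (hb : Computable b) (β₀ : β) :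
    ∃ g : ℕ → β, Computable g ∧ (∀ i, g i = β₀ ∨ ∃ t, τ t = true ∧ b t = g i) ∧
      ∀ t, τ t = true → ∃ i, g i = b t := by
  let sel : T → β := fun t => bif τ t then b t else β₀
  have hsel : Computable sel := Computable.cond hτ hb (Computable.const β₀)
  have hdec : Computable fun i : ℕ => (Encodable.decode i : Option T) := Computable.decode
  have h0 : Computable fun _ : ℕ => β₀ := Computable.const β₀
  have h1 : Computable₂ fun (_ : ℕ) (t : T) => sel t := (hsel.comp Computable.snd).to₂
  have hg := Computable.option_casesOn hdec h0 h1
  refine ⟨_, hg, fun i => ?_, fun t ht => ?_⟩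
  · cases hi : (Encodable.decode i : Option T) with
    | none => left; rfl
    | some t =>
      cases ht : τ t with
      | false => left; simp [sel, ht]
      | true => right; exact ⟨t, ht, by simp [sel, ht]⟩
  · exact ⟨Encodable.encode t, by simp [sel, ht]⟩

/-- The center of a rational ball. -/
def ctr (β : ℚ × ℚ × ℚ) : ℚ × ℚ := (β.1, β.2.1)

theorem comp_ctr {α : Type*} [Primcodable α] {f : α → ℚ × ℚ × ℚ} (hf : Computable f) :
    Computable fun a => ctr (f a) := (c1 hf).pair (c2 hf)

/-- Formal nesting of rational balls with radius at least halved. -/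
def nest (β' β : ℚ × ℚ × ℚ) : Bool :=
  decide (β'.2.2 + β'.2.2 ≤ β.2.2) &&
    decide (sqd (ctr β') (ctr β) ≤ (β.2.2 - β'.2.2) * (β.2.2 - β'.2.2))

theorem comp_nest {α : Type*} [Primcodable α] {f g : α → ℚ × ℚ × ℚ} (hf : Computable f)
    (hg : Computable g) : Computable fun a => nest (f a) (g a) := by
  have hr : Computable fun a => (g a).2.2 - (f a).2.2 := qsub (c3 hg) (c3 hf)
  have h1 : Computable fun a => decide ((f a).2.2 + (f a).2.2 ≤ (g a).2.2) :=
    qle (qadd (c3 hf) (c3 hf)) (c3 hg)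
  have h2 : Computable fun a => decide (sqd (ctr (f a)) (ctr (g a)) ≤
      ((g a).2.2 - (f a).2.2) * ((g a).2.2 - (f a).2.2)) :=
    qle (comp_sqd (comp_ctr hf) (comp_ctr hg)) (qmul hr hr)
  exact (cand h1 h2).of_eq fun a => rfl

theorem nest_iff {β' β : ℚ × ℚ × ℚ} (h' : 0 < β'.2.2) :
    nest β' β = true ↔ β'.2.2 + β'.2.2 ≤ β.2.2 ∧
      dist (ratPoint (ctr β')) (ratPoint (ctr β)) ≤ ((β.2.2 : ℝ) - β'.2.2) := by
  simp only [nest, Bool.and_eq_true, decide_eq_true_eq]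
  refine and_congr_right fun h => ?_
  rw [sqd_le (by linarith)]
  push_cast
  rfl

/-- A rational ball of radius at most one which meets `J`. -/
def Good (J : Set ℂ) (β : ℚ × ℚ × ℚ) : Prop :=
  0 < β.2.2 ∧ β.2.2 ≤ 1 ∧ (ball (ratPoint (ctr β)) (β.2.2 : ℝ) ∩ J).Nonempty

theorem exists_good_near {J : Set ℂ} {z : ℂ} (hz : z ∈ J) {ε : ℝ} (hε : 0 < ε) :
    ∃ β, Good J β ∧ (β.2.2 : ℝ) < ε ∧ dist (ratPoint (ctr β)) z < β.2.2 := by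
  obtain ⟨r, hr1, hr2⟩ := exists_rat_btwn (lt_min hε one_pos)
  obtain ⟨q, hq⟩ := exists_ratPoint_near z hr1
  refine ⟨(q.1, q.2, r), ⟨by exact_mod_cast hr1, ?_, z, ?_, hz⟩, hr2.trans_le (min_le_left _ _), hq⟩
  · have := hr2.trans_le (min_le_right _ _)
    exact_mod_cast this.le
  · rw [mem_ball, dist_comm]; exact hq

theorem lower_of_enum {J : Set ℂ} (hJ : IsClosed J) {g : ℕ → ℚ × ℚ × ℚ} (hg : Computable g)
    (h1 : ∀ i, Good J (g i)) (h2 : ∀ β, Good J β → ∃ i, g i = β) :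
    ∃ x : ℕ → ℂ, (∀ n, x n ∈ J) ∧ UniformlyComputableSeq x ∧ J ⊆ closure (Set.range x) := by
  -- the refinement step
  have hex : ∀ i, ∃ j, nest (g j) (g i) = true := by
    intro i
    obtain ⟨hr, hr1, z, hz, hzJ⟩ := h1 i
    have hr' : (0 : ℝ) < (g i).2.2 := by exact_mod_cast hr
    rw [mem_ball] at hz
    obtain ⟨β, hβ, hβε, hβz⟩ := exists_good_near hzJ
      (ε := min ((g i).2.2 / 2) (((g i).2.2 - dist z (ratPoint (ctr (g i)))) / 2))
      (lt_min (by linarith) (by linarith))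
    obtain ⟨j, hj⟩ := h2 β hβ
    refine ⟨j, ?_⟩
    rw [hj, nest_iff hβ.1]
    have e1 := hβε.trans_le (min_le_left _ _)
    have e2 := hβε.trans_le (min_le_right _ _)
    constructor
    · have : (β.2.2 : ℝ) + β.2.2 ≤ (g i).2.2 := by linarith
      exact_mod_cast this
    · have := dist_triangle (ratPoint (ctr β)) z (ratPoint (ctr (g i)))
      linarith
  have hcn : Computable₂ fun i j => nest (g j) (g i) :=
    Computable₂.mk (comp_nest (hg.comp Computable.snd) (hg.comp Computable.fst))
  obtain ⟨step, hstep, hst⟩ := comp_find' hcn hex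
  let idx : ℕ × ℕ → ℕ := fun p => Nat.rec p.1 (fun _ v => step v) p.2
  have hidx : Computable idx := by
    have ha : Computable₂ fun (_ : ℕ × ℕ) (q : ℕ × ℕ) => step q.2 :=
      Computable₂.mk ((hstep.comp Computable.snd).comp Computable.snd)
    exact Computable.nat_rec (f := fun p : ℕ × ℕ => p.2) Computable.snd Computable.fst ha
  have hidx0 : ∀ n, idx (n, 0) = n := fun n => rfl
  have hidxs : ∀ n m, idx (n, m + 1) = step (idx (n, m)) := fun n m => rfl
  let y : ℕ → ℕ → ℂ := fun n m => ratPoint (ctr (g (idx (n, m))))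
  let r : ℕ → ℕ → ℝ := fun n m => ((g (idx (n, m))).2.2 : ℝ)
  have hrpos : ∀ n m, 0 < r n m := fun n m => by
    have := (h1 (idx (n, m))).1
    show (0 : ℝ) < ((g (idx (n, m))).2.2 : ℝ)
    exact_mod_cast this
  have hnest : ∀ n m, r n (m + 1) + r n (m + 1) ≤ r n m ∧
      dist (y n (m + 1)) (y n m) ≤ r n m - r n (m + 1) := by
    intro n m
    have h3 := (nest_iff (h1 _).1).1 (hst (idx (n, m)))
    rw [← hidxs] at h3
    refine ⟨?_, h3.2⟩
    show ((g (idx (n, m + 1))).2.2 : ℝ) + ((g (idx (n, m + 1))).2.2 : ℝ) ≤ ((g (idx (n, m))).2.2 : ℝ)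
    exact_mod_cast h3.1
  have hr2 : ∀ n m, r n m ≤ (1 / 2) ^ m := by
    intro n m
    induction m with
    | zero =>
      have := (h1 (idx (n, 0))).2.1
      show ((g (idx (n, 0))).2.2 : ℝ) ≤ _
      rw [pow_zero]
      exact_mod_cast this
    | succ m ih =>
      have := (hnest n m).1
      rw [pow_succ]
      linarith
  have hle : ∀ n m k, dist (y n (m + k)) (y n m) ≤ r n m - r n (m + k) := by
    intro n m k
    induction k with
    | zero => simp
    | succ k ih =>
      have h4 := (hnest n (m + k)).2
      have h5 := dist_triangle (y n (m + k + 1)) (y n (m + k)) (y n m)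
      rw [← add_assoc]
      linarith
  have hr0 : ∀ n, Tendsto (r n) atTop (nhds 0) := fun n =>
    squeeze_zero (fun m => (hrpos n m).le) (hr2 n)
      (tendsto_pow_atTop_nhds_zero_of_lt_one (by norm_num) (by norm_num))
  have hcau : ∀ n, CauchySeq (y n) := by
    intro n
    refine cauchySeq_of_le_tendsto_0' (r n) (fun m k hmk => ?_) (hr0 n)
    obtain ⟨j, rfl⟩ := Nat.exists_eq_add_of_le hmk
    have := hle n m j
    rw [dist_comm]
    linarith [hrpos n (m + j)]
  have hlim : ∀ n, ∃ x, Tendsto (y n) atTop (nhds x) := fun n => cauchySeq_tendsto_of_complete (hcau n)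
  choose x hx using hlim
  have hdist : ∀ n m, dist (y n m) (x n) ≤ r n m := by
    intro n m
    have h6 : Tendsto (fun k => dist (y n m) (y n k)) atTop (nhds (dist (y n m) (x n))) :=
      tendsto_const_nhds.dist (hx n)
    refine le_of_tendsto h6 ?_
    filter_upwards [eventually_ge_atTop m] with k hk
    obtain ⟨j, rfl⟩ := Nat.exists_eq_add_of_le hk
    have := hle n m j
    rw [dist_comm]
    linarith [hrpos n (m + j)]
  refine ⟨x, ?_, ⟨fun p => ctr (g (idx p)), comp_ctr (hg.comp hidx), ?_⟩, ?_⟩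
  · intro n
    have hz : ∀ m, ∃ z ∈ J, dist z (y n m) ≤ r n m := by
      intro m
      obtain ⟨-, -, z, hz, hzJ⟩ := h1 (idx (n, m))
      exact ⟨z, hzJ, (mem_ball.1 hz).le⟩
    choose w hwJ hw using hz
    refine hJ.mem_of_tendsto (b := atTop) (f := w) ?_ (Eventually.of_forall hwJ)
    rw [tendsto_iff_dist_tendsto_zero]
    refine squeeze_zero (g := fun m => r n m + r n m) (fun _ => dist_nonneg) (fun m => ?_)
      (by simpa using (hr0 n).add (hr0 n))
    exact (dist_triangle _ (y n m) _).trans (add_le_add (hw m) (hdist n m))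
  · intro n m
    exact (hdist n m).trans (hr2 n m)
  · intro z hz
    rw [Metric.mem_closure_iff]
    intro ε hε
    obtain ⟨β, hβ, hβε, hβz⟩ := exists_good_near hz (half_pos hε)
    obtain ⟨n, hn⟩ := h2 β hβ
    refine ⟨x n, ⟨n, rfl⟩, ?_⟩
    have h7 := hdist n 0
    have h8 : y n 0 = ratPoint (ctr β) := by
      show ratPoint (ctr (g (idx (n, 0)))) = _
      rw [hidx0, hn]
    have h9 : r n 0 = (β.2.2 : ℝ) := by
      show ((g (idx (n, 0))).2.2 : ℝ) = _
      rw [hidx0, hn]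
    rw [h8, h9] at h7
    have := dist_triangle_left z (x n) (ratPoint (ctr β))
    linarith

/-- Witness type: a ball, three indices, a center and radius for a preperiodic point,
and a center for an escaping point. -/
abbrev Wit := (ℚ × ℚ × ℚ) × (ℕ × ℕ × ℕ) × (ℚ × ℚ × ℚ) × (ℚ × ℚ)

/-- First part of the test: geometry. -/
def testA (t : Wit) : Bool :=
  ((decide (0 < t.2.2.1.2.2) && decide (t.1.2.2 ≤ 1)) &&
    decide (t.2.2.1.2.2 ≤ t.1.2.2)) &&
  (decide (sqd (ctr t.2.2.1) (ctr t.1) ≤ (t.1.2.2 - t.2.2.1.2.2) * (t.1.2.2 - t.2.2.1.2.2)) &&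
    decide (sqd t.2.2.2 (ctr t.1) < t.1.2.2 * t.1.2.2))

/-- Second part of the test: root certificate. -/
def testB (Θ : ℕ × (ℚ × ℚ) × ℕ → ℚ × ℚ × ℚ) (l : ℚ) (d : ℕ) (t : Wit) : Bool :=
  decide (nrm ((Θ (t.2.1.1 + 1, ctr t.2.2.1, t.2.1.2.2)).1 - (Θ (t.2.1.1, ctr t.2.2.1, t.2.1.2.2)).1)
      ((Θ (t.2.1.1 + 1, ctr t.2.2.1, t.2.1.2.2)).2.1 - (Θ (t.2.1.1, ctr t.2.2.1, t.2.1.2.2)).2.1)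
    + ((Θ (t.2.1.1 + 1, ctr t.2.2.1, t.2.1.2.2)).2.2 + (Θ (t.2.1.1, ctr t.2.2.1, t.2.1.2.2)).2.2)
    < (l * t.2.2.1.2.2) ^ (d ^ (t.2.1.1 + 1)))

/-- Third part of the test: escape certificate. -/
def testC (Θ : ℕ × (ℚ × ℚ) × ℕ → ℚ × ℚ × ℚ) (R : ℚ) (t : Wit) : Bool :=
  decide ((R + (Θ (t.2.1.2.1, t.2.2.2, t.2.1.2.2)).2.2) * (R + (Θ (t.2.1.2.1, t.2.2.2, t.2.1.2.2)).2.2)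
    < sqd (ctr (Θ (t.2.1.2.1, t.2.2.2, t.2.1.2.2))) (0, 0))

theorem wBall : Computable fun t : Wit => t.1 := Computable.fst
theorem wIdx : Computable fun t : Wit => t.2.1 := Computable.fst.comp Computable.snd
theorem wRest : Computable fun t : Wit => t.2.2 := Computable.snd.comp Computable.snd
theorem wN : Computable fun t : Wit => t.2.1.1 := Computable.fst.comp wIdx
theorem wM : Computable fun t : Wit => t.2.1.2.1 :=
  Computable.fst.comp (Computable.snd.comp wIdx)
theorem wK : Computable fun t : Wit => t.2.1.2.2 :=
  Computable.snd.comp (Computable.snd.comp wIdx)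
theorem wC : Computable fun t : Wit => t.2.2.1 := Computable.fst.comp wRest
theorem wE : Computable fun t : Wit => t.2.2.2 := Computable.snd.comp wRest
theorem wr : Computable fun t : Wit => t.1.2.2 := c3 wBall
theorem ws : Computable fun t : Wit => t.2.2.1.2.2 := c3 wC
theorem wcC : Computable fun t : Wit => ctr t.2.2.1 := comp_ctr wC
theorem wcB : Computable fun t : Wit => ctr t.1 := comp_ctr wBall
theorem wN1 : Computable fun t : Wit => t.2.1.1 + 1 := cadd wN (Computable.const 1)

theorem comp_testA : Computable testA := by
  have h1 : Computable fun t : Wit => decide (0 < t.2.2.1.2.2) := qlt (Computable.const 0) ws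
  have h2 : Computable fun t : Wit => decide (t.1.2.2 ≤ 1) := qle wr (Computable.const 1)
  have h3 : Computable fun t : Wit => decide (t.2.2.1.2.2 ≤ t.1.2.2) := qle ws wr
  have hd : Computable fun t : Wit => t.1.2.2 - t.2.2.1.2.2 := qsub wr ws
  have hd2 : Computable fun t : Wit => (t.1.2.2 - t.2.2.1.2.2) * (t.1.2.2 - t.2.2.1.2.2) :=
    qmul hd hd
  have hs : Computable fun t : Wit => sqd (ctr t.2.2.1) (ctr t.1) := comp_sqd wcC wcB
  have h4 : Computable fun t : Wit => decide (sqd (ctr t.2.2.1) (ctr t.1) ≤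
      (t.1.2.2 - t.2.2.1.2.2) * (t.1.2.2 - t.2.2.1.2.2)) := qle hs hd2
  have hs' : Computable fun t : Wit => sqd t.2.2.2 (ctr t.1) := comp_sqd wE wcB
  have hr2 : Computable fun t : Wit => t.1.2.2 * t.1.2.2 := qmul wr wr
  have h5 : Computable fun t : Wit => decide (sqd t.2.2.2 (ctr t.1) < t.1.2.2 * t.1.2.2) :=
    qlt hs' hr2
  exact (cand (cand (cand h1 h2) h3) (cand h4 h5)).of_eq fun t => rfl

theorem comp_testB {Θ : ℕ × (ℚ × ℚ) × ℕ → ℚ × ℚ × ℚ} (hΘ : Computable Θ) (l : ℚ) (d : ℕ) :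
    Computable (testB Θ l d) := by
  have hu : Computable fun t : Wit => Θ (t.2.1.1 + 1, ctr t.2.2.1, t.2.1.2.2) :=
    hΘ.comp (wN1.pair (wcC.pair wK))
  have hv : Computable fun t : Wit => Θ (t.2.1.1, ctr t.2.2.1, t.2.1.2.2) :=
    hΘ.comp (wN.pair (wcC.pair wK))
  have hn := comp_nrm (qsub (c1 hu) (c1 hv)) (qsub (c2 hu) (c2 hv))
  have he := qadd (c3 hu) (c3 hv)
  have hl : Computable fun t : Wit => l * t.2.2.1.2.2 := qmul (Computable.const l) ws
  have hexp : Computable fun t : Wit => d ^ (t.2.1.1 + 1) := cpow (Computable.const d) wN1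
  have hp := qpow hl hexp
  exact (qlt (qadd hn he) hp).of_eq fun t => rfl

theorem comp_testC {Θ : ℕ × (ℚ × ℚ) × ℕ → ℚ × ℚ × ℚ} (hΘ : Computable Θ) (R : ℚ) :
    Computable (testC Θ R) := by
  have hu : Computable fun t : Wit => Θ (t.2.1.2.1, t.2.2.2, t.2.1.2.2) :=
    hΘ.comp (wM.pair (wE.pair wK))
  have hr := qadd (Computable.const R) (c3 hu)
  have hz : Computable fun _ : Wit => ((0, 0) : ℚ × ℚ) := Computable.const _
  have hs := comp_sqd (comp_ctr hu) hz
  exact (qlt (qmul hr hr) hs).of_eq fun t => rfl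

theorem ratPoint_zero : ratPoint (0, 0) = 0 := by
  apply Complex.ext <;> simp [ratPoint]

section
variable {P : Polynomial ℂ} {κ R : ℝ} {Θ : ℕ × (ℚ × ℚ) × ℕ → ℚ × ℚ × ℚ} {l R' : ℚ}

theorem test_sound (h : Esc P κ R) (hdeg : 2 ≤ P.natDegree)
    (hΘ : ∀ n c k, inB (Θ (n, c, k)) ((fun z => P.eval z)^[n] (ratPoint c)))
    (hl : 0 < l) (hl1 : l ≤ 1) (hlP : (l : ℝ) ≤ ‖P.leadingCoeff‖) (hR : R ≤ R') {t : Wit}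
    (hA : testA t = true) (hB : testB Θ l P.natDegree t = true) (hC : testC Θ R' t = true) :
    Good (juliaSet (fun z => P.eval z)) t.1 := by
  obtain ⟨β, ⟨n, m, k⟩, γ, e⟩ := t
  simp only [testA, Bool.and_eq_true, decide_eq_true_eq] at hA
  simp only [testB, decide_eq_true_eq] at hB
  simp only [testC, decide_eq_true_eq] at hC
  obtain ⟨⟨⟨hs, hr1⟩, hsr⟩, hcs, hce⟩ := hA
  have hr : 0 < β.2.2 := hs.trans_le hsr
  rw [sqd_le (by linarith)] at hcs
  rw [sqd_lt hr.le] at hce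
  push_cast at hcs
  have hs' : (0 : ℝ) < γ.2.2 := by exact_mod_cast hs
  refine ⟨hr, hr1, ?_⟩
  -- preperiodic point
  have hu := hΘ (n + 1) (ctr γ) k
  have hv := hΘ n (ctr γ) k
  simp only [inB] at hu hv
  set u := Θ (n + 1, ctr γ, k)
  set v := Θ (n, ctr γ, k)
  have hB' : (nrm (u.1 - v.1) (u.2.1 - v.2.1) : ℝ) + ((u.2.2 : ℝ) + v.2.2) <
      ((l : ℝ) * γ.2.2) ^ (P.natDegree ^ (n + 1)) := by exact_mod_cast hB
  have huv := norm_ratPoint_le (u.1 - v.1) (u.2.1 - v.2.1)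
  rw [← ratPoint_sub] at huv
  obtain ⟨w, hw, hwc⟩ := exists_near_fix P hdeg (l := (l : ℝ)) (by exact_mod_cast hl)
    (by exact_mod_cast hl1) hlP n (c := ratPoint (ctr γ)) hs' (by
      refine lt_of_le_of_lt ?_ hB'
      generalize (fun z => P.eval z)^[n + 1] (ratPoint (ctr γ)) = p at *
      generalize (fun z => P.eval z)^[n] (ratPoint (ctr γ)) = q at *
      calc ‖p - q‖ = ‖(ratPoint (u.1, u.2.1) - ratPoint (v.1, v.2.1)) +
            ((p - ratPoint (u.1, u.2.1)) - (q - ratPoint (v.1, v.2.1)))‖ := by congr 1; ring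
        _ ≤ _ := (norm_add_le _ _).trans (add_le_add huv ((norm_sub_le _ _).trans
            (add_le_add hu hv))))
  have hwK := mem_filledJulia_of_fix hw
  -- escaping point
  have hy := hΘ m e k
  simp only [inB] at hy
  set y := Θ (m, e, k)
  have hy0 : (0 : ℝ) ≤ y.2.2 := (norm_nonneg _).trans hy
  have hR0 : (0 : ℝ) ≤ R' := by linarith [h.oneR]
  have hsum : 0 ≤ R' + y.2.2 := by
    have : (0 : ℝ) ≤ (R' : ℝ) + y.2.2 := by linarith
    exact_mod_cast this
  rw [lt_sqd hsum, ratPoint_zero, dist_zero_right] at hC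
  push_cast at hC
  have heK : ratPoint e ∉ filledJulia (fun z => P.eval z) := by
    intro hK
    have h1 := (mem_filledJulia h hdeg _).1 hK m
    have h2 := norm_le_norm_add_norm_sub' (ratPoint (ctr y)) ((fun z => P.eval z)^[m] (ratPoint e))
    have h3 : ‖ratPoint (ctr y) - (fun z => P.eval z)^[m] (ratPoint e)‖ ≤ y.2.2 := by
      rw [norm_sub_rev]; exact hy
    linarith
  refine meets_of (isClosed_filledJulia h hdeg) (w := w) (e := ratPoint e) ?_ hwK ?_ heK
  · rw [mem_ball]
    show dist w (ratPoint (ctr β)) < (β.2.2 : ℝ)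
    have htri := dist_triangle w (ratPoint (ctr γ)) (ratPoint (ctr β))
    rw [← dist_eq_norm] at hwc
    linarith [hwc, hcs]
  · exact hce

theorem test_complete (h : Esc P κ R) (hdeg : 2 ≤ P.natDegree)
    (hΘ : ∀ n c k, inB (Θ (n, c, k)) ((fun z => P.eval z)^[n] (ratPoint c)))
    (hΘ0 : ∀ n c, Tendsto (fun k => ((Θ (n, c, k)).2.2 : ℝ)) atTop (nhds 0))
    (hl : 0 < l) (hR : R ≤ R') {β : ℚ × ℚ × ℚ} (hβ : Good (juliaSet (fun z => P.eval z)) β) :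
    ∃ t : Wit, (testA t = true ∧ testB Θ l P.natDegree t = true ∧ testC Θ R' t = true) ∧ t.1 = β := by
  obtain ⟨hr, hr1, hmeet⟩ := hβ
  obtain ⟨⟨w, hw, n, hn⟩, e₀, he₀, he₀K⟩ := of_meets P hdeg h hmeet
  rw [mem_ball] at hw
  -- escaping rational point
  have hopen : IsOpen (ball (ratPoint (ctr β)) (β.2.2 : ℝ) ∩ (filledJulia (fun z => P.eval z))ᶜ) :=
    isOpen_ball.inter (isClosed_filledJulia h hdeg).isOpen_compl
  obtain ⟨ε, hε, hεs⟩ := Metric.isOpen_iff.1 hopen e₀ ⟨he₀, he₀K⟩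
  obtain ⟨e, he⟩ := exists_ratPoint_near e₀ hε
  obtain ⟨heb, heK⟩ := hεs (mem_ball.2 he)
  have hesc : ∃ m₀, R ≤ ‖(fun z => P.eval z)^[m₀] (ratPoint e)‖ := by
    by_contra! hcon
    exact heK ((mem_filledJulia h hdeg _).2 hcon)
  obtain ⟨m₀, hm₀⟩ := hesc
  obtain ⟨m, hm⟩ := ((h.tendsto hdeg hm₀).eventually_gt_atTop ((R' : ℝ) + 1)).exists
  -- near preperiodic point
  obtain ⟨s, hs1, hs2⟩ := exists_rat_btwn
    (show (0 : ℝ) < ((β.2.2 : ℝ) - dist w (ratPoint (ctr β))) / 2 by linarith)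
  have hs : 0 < s := by exact_mod_cast hs1
  set η : ℝ := ((l : ℝ) * s) ^ (P.natDegree ^ (n + 1)) with hη
  have hl' : (0 : ℝ) < l := by exact_mod_cast hl
  have hηpos : 0 < η := by positivity
  have hcont : Continuous fun z => ‖(fun z => P.eval z)^[n + 1] z - (fun z => P.eval z)^[n] z‖ :=
    ((cont_iter P (n + 1)).sub (cont_iter P n)).norm
  have hnb : ∀ᶠ z in nhds w, ‖(fun z => P.eval z)^[n + 1] z - (fun z => P.eval z)^[n] z‖ < η / 8 := by
    refine hcont.continuousAt.eventually_lt continuousAt_const ?_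
    rw [hn, sub_self, norm_zero]
    positivity
  obtain ⟨δ, hδ, hδs⟩ := Metric.eventually_nhds_iff.1 hnb
  obtain ⟨c, hc⟩ := exists_ratPoint_near w (lt_min hδ hs1)
  have hcη := hδs (hc.trans_le (min_le_left _ _))
  have hcs := hc.trans_le (min_le_right _ _)
  -- precision
  obtain ⟨k, ⟨hk1, hk2⟩, hk3⟩ := (((hΘ0 (n + 1) c).eventually_lt_const (u := η / 8) (by positivity)).and
    ((hΘ0 n c).eventually_lt_const (u := η / 8) (by positivity))).and
    ((hΘ0 m e).eventually_lt_const (u := 1 / 4) (by norm_num)) |>.exists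
  refine ⟨(β, (n, m, k), (c.1, c.2, s), e), ⟨?_, ?_, ?_⟩, rfl⟩
  · have hsr : s ≤ β.2.2 := by
      have : (s : ℝ) ≤ β.2.2 := by
        have := dist_nonneg (x := w) (y := ratPoint (ctr β))
        linarith
      exact_mod_cast this
    simp only [testA, Bool.and_eq_true, decide_eq_true_eq]
    refine ⟨⟨⟨hs, hr1⟩, hsr⟩, ?_, ?_⟩
    · rw [sqd_le (by linarith)]
      push_cast
      show dist (ratPoint c) (ratPoint (ctr β)) ≤ _
      have := dist_triangle (ratPoint c) w (ratPoint (ctr β))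
      linarith
    · rw [sqd_lt hr.le]
      exact heb
  · simp only [testB, decide_eq_true_eq]
    show nrm ((Θ (n + 1, c, k)).1 - (Θ (n, c, k)).1) ((Θ (n + 1, c, k)).2.1 - (Θ (n, c, k)).2.1)
      + ((Θ (n + 1, c, k)).2.2 + (Θ (n, c, k)).2.2) < (l * s) ^ (P.natDegree ^ (n + 1))
    have hu := hΘ (n + 1) c k
    have hv := hΘ n c k
    simp only [inB] at hu hv
    set u := Θ (n + 1, c, k)
    set v := Θ (n, c, k)
    have huv := nrm_le (u.1 - v.1) (u.2.1 - v.2.1)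
    rw [← ratPoint_sub] at huv
    have hd : ‖ratPoint (u.1, u.2.1) - ratPoint (v.1, v.2.1)‖ ≤ η / 8 + (u.2.2 + v.2.2) := by
      generalize (fun z => P.eval z)^[n + 1] (ratPoint c) = p at *
      generalize (fun z => P.eval z)^[n] (ratPoint c) = q at *
      calc ‖ratPoint (u.1, u.2.1) - ratPoint (v.1, v.2.1)‖ = ‖(p - q) -
            ((p - ratPoint (u.1, u.2.1)) - (q - ratPoint (v.1, v.2.1)))‖ := by congr 1; ring
        _ ≤ _ := (norm_sub_le _ _).trans (add_le_add hcη.le ((norm_sub_le _ _).trans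
            (add_le_add hu hv)))
    have : (nrm (u.1 - v.1) (u.2.1 - v.2.1) : ℝ) + ((u.2.2 : ℝ) + v.2.2) < η := by linarith
    rw [hη] at this
    exact_mod_cast this
  · simp only [testC, decide_eq_true_eq]
    have hy := hΘ m e k
    simp only [inB] at hy
    set y := Θ (m, e, k)
    have hy0 : (0 : ℝ) ≤ y.2.2 := (norm_nonneg _).trans hy
    have hR0 : (0 : ℝ) ≤ R' := by linarith [h.oneR]
    have hsum : 0 ≤ R' + y.2.2 := by
      have : (0 : ℝ) ≤ (R' : ℝ) + y.2.2 := by linarith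
      exact_mod_cast this
    rw [lt_sqd hsum, ratPoint_zero, dist_zero_right]
    push_cast
    have h2 := norm_le_norm_add_norm_sub' ((fun z => P.eval z)^[m] (ratPoint e)) (ratPoint (ctr y))
    have h3 : ‖(fun z => P.eval z)^[m] (ratPoint e) - ratPoint (ctr y)‖ ≤ y.2.2 := hy
    linarith

end

/-- The Julia set of a computable polynomial of degree ≥ 2 is lower computable:
there is a uniformly computable sequence of points of `J(P)` which is dense in `J(P)`. -/
theorem juliaSet_lowerComputable (P : Polynomial ℂ) (hdeg : 2 ≤ P.natDegree)
    (hP : ∀ i : ℕ, ComputableComplex (P.coeff i)) :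
    ∃ x : ℕ → ℂ, (∀ n, x n ∈ juliaSet (fun z : ℂ => P.eval z)) ∧
      UniformlyComputableSeq x ∧
      juliaSet (fun z : ℂ => P.eval z) ⊆ closure (Set.range x) := by
  obtain ⟨κ, R, h1, h2, h3, h4, h5⟩ := exists_lower P hdeg
  have h : Esc P κ R := ⟨h1, h2, h3, h4, h5⟩
  obtain ⟨Θ, hΘc, hΘ, hΘ0⟩ := IC_iter (IC_poly P hP)
  obtain ⟨R', hR', -⟩ := exists_rat_btwn (show R < R + 1 by linarith)
  have hlead : 0 < ‖P.leadingCoeff‖ := by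
    rw [norm_pos_iff, leadingCoeff_ne_zero]
    rintro rfl
    simp at hdeg
  obtain ⟨l, hl0, hl1⟩ := exists_rat_btwn (lt_min hlead one_pos)
  have hl : 0 < l := by exact_mod_cast hl0
  have hlP := (hl1.trans_le (min_le_left _ _)).le
  have hl1' : l ≤ 1 := by
    have := (hl1.trans_le (min_le_right _ _)).le
    exact_mod_cast this
  obtain ⟨z, hz⟩ := juliaSet_nonempty P hdeg h
  obtain ⟨β₀, hβ₀, -, -⟩ := exists_good_near hz one_pos
  have hτ : Computable fun t : Wit => testA t && (testB Θ l P.natDegree t && testC Θ R' t) :=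
    cand comp_testA (cand (comp_testB hΘc l P.natDegree) (comp_testC hΘc R'))
  obtain ⟨g, hg, hg1, hg2⟩ := enum_of_test hτ wBall β₀
  refine lower_of_enum isClosed_frontier hg (fun i => ?_) (fun β hβ => ?_)
  · rcases hg1 i with hi | ⟨t, ht, hi⟩
    · rw [hi]; exact hβ₀
    · rw [← hi]
      simp only [Bool.and_eq_true] at ht
      exact test_sound h hdeg hΘ hl hl1' hlP hR'.le ht.1 ht.2.1 ht.2.2
  · obtain ⟨t, ⟨hA, hB, hC⟩, rfl⟩ := test_complete h hdeg hΘ hΘ0 hl hR'.le hβ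
    exact hg2 t (by simp only [Bool.and_eq_true]; exact ⟨hA, hB, hC⟩)
end
end
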